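/- arXiv:1701.01981 — 7 statements merged into one kernel-verified Lean document; each statement's English description precedes it below -/
import Mathlib

section
/- Let 𝒵 be a finite set and let Z be drawn from 𝒵 according to an arbitrary conditional PMF P_{Z|X,Y}, so (X,Y,Z) ~ P_{X,Y} × P_{Z|X,Y}. Let G*(·|Y,Z) be an optimal guessing function for X given (Y,Z) and let G*(·|Y) be an optimal guessing function for X given Y. Then E[G*(X|Y,Z)^ρ] ≥ E[⌈G*(X|Y)/|𝒵|⌉^ρ]. Moreover, equality holds whenever Z = f(X,Y) for a mapping f : 𝒳×𝒴 → 𝒵 such that f(x,y) = f(x̃,y) implies either ⌈G*(x|y)/|𝒵|⌉ ≠ ⌈G*(x̃|y)/|𝒵|⌉ or x = x̃; and such a mapping always exists, because for every l ∈ ℕ at most |𝒵| different x ∈ 𝒳 satisfy ⌈G*(x|y)/|𝒵|⌉ = l. -/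
open scoped BigOperators

noncomputable section

/-- `G` is a guessing function for `X` given side information in `V`:
for every `v`, `G v` is a bijection from `X` onto `{1, …, |X|}`. -/
def IsGuess {X V : Type*} [Fintype X] (G : V → X → ℕ) : Prop :=
  ∀ v : V, Set.BijOn (G v) Set.univ (Set.Icc 1 (Fintype.card X))

/-- Discrete layer-cake formula for a function of a bounded natural number. -/
theorem sum_range_ite_le_sub (φ : ℕ → ℝ) {a N : ℕ} (h : a ≤ N) :
    ∑ t ∈ Finset.range N, (if a ≤ t then φ (t + 1) - φ t else 0) = φ N - φ a := by
  induction N, h using Nat.le_induction with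
  | base =>
    rw [sub_self]
    refine Finset.sum_eq_zero fun t ht => if_neg ?_
    have := Finset.mem_range.1 ht
    omega
  | succ n hn ih =>
    rw [Finset.sum_range_succ, ih, if_pos hn]
    ring

/-- If the sublevel sets of `c` carry at least as much weight as those of `m`, then the weighted
sum of a monotone function of `c` is at most that of `m`. -/
theorem sum_mul_le_sum_mul_of_sublevel {X : Type*} [Fintype X] (q : X → ℝ) (c m : X → ℕ)
    {φ : ℕ → ℝ} (hφ : Monotone φ)
    (h : ∀ t, ∑ x with m x ≤ t, q x ≤ ∑ x with c x ≤ t, q x) :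
    ∑ x, q x * φ (c x) ≤ ∑ x, q x * φ (m x) := by
  obtain ⟨N, hN⟩ : ∃ N, ∀ x, c x ≤ N ∧ m x ≤ N :=
    ⟨∑ x, (c x + m x), fun x => by
      have := Finset.single_le_sum (f := fun x => c x + m x) (fun _ _ => Nat.zero_le _)
        (Finset.mem_univ x)
      omega⟩
  have key : ∀ a : X → ℕ, (∀ x, a x ≤ N) → ∑ x, q x * φ (a x) =
      ∑ x, q x * φ N - ∑ t ∈ Finset.range N, (φ (t + 1) - φ t) * ∑ x with a x ≤ t, q x := by
    intro a ha
    have : ∀ t, (φ (t + 1) - φ t) * ∑ x with a x ≤ t, q x =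
        ∑ x, q x * (if a x ≤ t then φ (t + 1) - φ t else 0) := by
      intro t
      rw [Finset.sum_filter, Finset.mul_sum]
      refine Finset.sum_congr rfl fun x _ => ?_
      split_ifs <;> ring
    simp_rw [this]
    rw [Finset.sum_comm, ← Finset.sum_sub_distrib]
    refine Finset.sum_congr rfl fun x _ => ?_
    rw [← Finset.mul_sum, sum_range_ite_le_sub φ (ha x)]
    ring
  rw [key c fun x => (hN x).1, key m fun x => (hN x).2]
  refine sub_le_sub_left (Finset.sum_le_sum fun t _ => ?_) _
  exact mul_le_mul_of_nonneg_left (h t) (sub_nonneg.2 (hφ (Nat.le_succ t)))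

/-- Among sets of at most a given size, a set holding the largest weights has the largest sum. -/
theorem sum_le_sum_of_card_le_of_dominates {X : Type*} [DecidableEq X] (q : X → ℝ)
    (hq : ∀ x, 0 ≤ q x) {s T : Finset X} (hcard : s.card ≤ T.card)
    (hT : ∀ x ∈ T, ∀ y ∉ T, q y ≤ q x) : ∑ x ∈ s, q x ≤ ∑ x ∈ T, q x := by
  suffices h : ∑ x ∈ s \ T, q x ≤ ∑ x ∈ T \ s, q x by
    have h1 := Finset.sum_inter_add_sum_sdiff s T q
    have h2 := Finset.sum_inter_add_sum_sdiff T s q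
    rw [Finset.inter_comm] at h2
    linarith
  have hc : (s \ T).card ≤ (T \ s).card := Finset.card_sdiff_le_card_sdiff_iff.2 hcard
  rcases (T \ s).eq_empty_or_nonempty with he | hne
  · rw [he, Finset.card_empty, Nat.le_zero, Finset.card_eq_zero] at hc
    rw [he, hc]
  · obtain ⟨x₀, hx₀, hmin⟩ := Finset.exists_min_image (T \ s) q hne
    calc ∑ x ∈ s \ T, q x ≤ (s \ T).card • q x₀ :=
          Finset.sum_le_card_nsmul _ _ _ fun x hx =>
            hT x₀ (Finset.mem_sdiff.1 hx₀).1 x (Finset.mem_sdiff.1 hx).2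
      _ ≤ (T \ s).card • q x₀ := by
          gcongr
          exact hq x₀
      _ ≤ ∑ x ∈ T \ s, q x := Finset.card_nsmul_le_sum _ _ _ hmin

theorem natCeil_div_le_iff {K : ℕ} (hK : 0 < K) (a t : ℕ) :
    ⌈(a : ℝ) / (K : ℝ)⌉₊ ≤ t ↔ a ≤ t * K := by
  rw [Nat.ceil_le, div_le_iff₀ (by exact_mod_cast hK)]
  exact_mod_cast Iff.rfl

theorem min_card_le_card_filter_le {X : Type*} [Fintype X] {G : X → ℕ}
    (hG : Set.BijOn G Set.univ (Set.Icc 1 (Fintype.card X))) (k : ℕ) :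
    min k (Fintype.card X) ≤ (Finset.univ.filter fun x => G x ≤ k).card := by
  classical
  calc min k (Fintype.card X) = (Finset.Icc 1 (min k (Fintype.card X))).card := by simp
    _ ≤ ((Finset.univ.filter fun x => G x ≤ k).image G).card := by
        refine Finset.card_le_card fun j hj => ?_
        rw [Finset.mem_Icc, le_min_iff] at hj
        obtain ⟨x, -, rfl⟩ := hG.surjOn ⟨hj.1, hj.2.2⟩
        simpa using ⟨x, hj.2.1, rfl⟩
    _ ≤ _ := Finset.card_image_le

theorem card_filter_selected_guess_le {X Z : Type*} [Fintype X] [Fintype Z] {g : Z → X → ℕ}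
    (hg : IsGuess g) (ζ : X → Z) (t : ℕ) :
    (Finset.univ.filter fun x => g (ζ x) x ≤ t).card ≤ t * Fintype.card Z := by
  calc _ ≤ (Finset.Icc 1 t ×ˢ (Finset.univ : Finset Z)).card := by
        refine Finset.card_le_card_of_injOn (fun x => (g (ζ x) x, ζ x)) (fun x hx => ?_) ?_
        · have h1 := ((hg (ζ x)).mapsTo (Set.mem_univ x)).1
          simpa using ⟨h1, by simpa using hx⟩
        · intro x _ x' _ h
          obtain ⟨h1, h2⟩ := Prod.mk.inj h
          rw [← h2] at h1
          exact (hg (ζ x)).injOn (Set.mem_univ _) (Set.mem_univ _) h1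
    _ = t * Fintype.card Z := by simp

/-- The rounded-up rank `⌈G / |Z|⌉` is a lower bound in the mean for any guess that may choose its
guessing order among `|Z|` many, when `G` guesses in decreasing order of weight. -/
theorem sum_ceil_div_le_sum_selected_guess {X Z : Type*} [Fintype X] [Fintype Z] [Nonempty Z]
    (q : X → ℝ) (hq : ∀ x, 0 ≤ q x) {G : X → ℕ}
    (hG : Set.BijOn G Set.univ (Set.Icc 1 (Fintype.card X)))
    (hanti : ∀ x x', G x ≤ G x' → q x' ≤ q x) {g : Z → X → ℕ} (hg : IsGuess g) (ζ : X → Z)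
    {φ : ℕ → ℝ} (hφ : Monotone φ) :
    ∑ x, q x * φ ⌈(G x : ℝ) / (Fintype.card Z : ℝ)⌉₊ ≤ ∑ x, q x * φ (g (ζ x) x) := by
  classical
  refine sum_mul_le_sum_mul_of_sublevel q _ _ hφ fun t => ?_
  simp_rw [natCeil_div_le_iff Fintype.card_pos]
  refine sum_le_sum_of_card_le_of_dominates q hq ?_ ?_
  · refine le_trans (le_min (card_filter_selected_guess_le hg ζ t) ?_)
      (min_card_le_card_filter_le hG _)
    exact Finset.card_le_univ _
  · intro x hx y hy
    simp only [Finset.mem_filter, Finset.mem_univ, true_and] at hx hy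
    exact hanti x y (by omega)

/-- An optimal guessing function guesses in decreasing order of weight. -/
theorem weight_le_of_guess_le {X : Type*} [Fintype X] (q : X → ℝ) {G : X → ℕ}
    (hG : Set.BijOn G Set.univ (Set.Icc 1 (Fintype.card X))) {φ : ℕ → ℝ} (hφ : StrictMono φ)
    (hopt : ∀ H : X → ℕ, Set.BijOn H Set.univ (Set.Icc 1 (Fintype.card X)) →
      ∑ x, q x * φ (G x) ≤ ∑ x, q x * φ (H x))
    {a b : X} (hab : G a ≤ G b) : q b ≤ q a := by
  classical
  rcases eq_or_ne a b with rfl | hne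
  · exact le_rfl
  have hlt : φ (G a) < φ (G b) :=
    hφ (lt_of_le_of_ne hab fun h => hne (hG.injOn (Set.mem_univ _) (Set.mem_univ _) h))
  have h := hopt (G ∘ Equiv.swap a b)
    (hG.comp ((Equiv.swap a b).bijective.bijOn_univ))
  rw [← sub_nonneg, ← Finset.sum_sub_distrib, Fintype.sum_eq_add a b hne] at h
  · simp only [Function.comp_apply, Equiv.swap_apply_left, Equiv.swap_apply_right] at h
    nlinarith
  · intro x hx
    simp [Equiv.swap_apply_of_ne_of_ne hx.1 hx.2]

/-- Optimality of a guessing function localizes to each value of the side information. -/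
theorem sum_le_sum_of_optimal_guess {X Y : Type*} [Fintype X] [Fintype Y] (p : X → Y → ℝ)
    (φ : ℕ → ℝ) {G : Y → X → ℕ} (hG : IsGuess G)
    (hopt : ∀ H : Y → X → ℕ, IsGuess H →
      ∑ x, ∑ y, p x y * φ (G y x) ≤ ∑ x, ∑ y, p x y * φ (H y x))
    (y : Y) (h : X → ℕ) (hh : Set.BijOn h Set.univ (Set.Icc 1 (Fintype.card X))) :
    ∑ x, p x y * φ (G y x) ≤ ∑ x, p x y * φ (h x) := by
  classical
  have key := hopt (Function.update G y h) fun v => by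
    rcases eq_or_ne v y with rfl | hv
    · simpa using hh
    · simpa [hv] using hG v
  rw [Finset.sum_comm, Finset.sum_comm (γ := X), ← Finset.add_sum_erase _ _ (Finset.mem_univ y),
    ← Finset.add_sum_erase (a := y) _ _ (Finset.mem_univ y)] at key
  have hrest : ∑ v ∈ Finset.univ.erase y, ∑ x, p x v * φ (Function.update G y h v x) =
      ∑ v ∈ Finset.univ.erase y, ∑ x, p x v * φ (G v x) :=
    Finset.sum_congr rfl fun v hv => by
      rw [Function.update_of_ne (Finset.ne_of_mem_erase hv)]
  rw [hrest, Function.update_self] at key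
  linarith

/-- An injective assignment of ranks on a subset extends to a full guessing order. -/
theorem exists_bijOn_extending {X : Type*} [Fintype X] (A : Finset X) (c : X → ℕ)
    (hc : ∀ x ∈ A, c x ∈ Set.Icc 1 (Fintype.card X)) (hinj : Set.InjOn c A) :
    ∃ g : X → ℕ, Set.BijOn g Set.univ (Set.Icc 1 (Fintype.card X)) ∧ ∀ x ∈ A, g x = c x := by
  obtain ⟨e, he⟩ := Finset.exists_equiv_extend_of_card_eq
    (t := Finset.Icc 1 (Fintype.card X)) (by simp) (s := A) (f := c)
    (by
      intro j hj
      obtain ⟨x, hx, rfl⟩ := Finset.mem_image.1 hj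
      simpa using hc x hx) hinj
  refine ⟨fun x => e x, ⟨fun x _ => Finset.mem_Icc.1 (e x).2,
    fun x _ x' _ h => e.injective (Subtype.ext h), fun j hj => ?_⟩, he⟩
  exact ⟨e.symm ⟨j, by simpa using hj⟩, Set.mem_univ _, by simp⟩

/-- Numbers with the same residue modulo `K` and the same value of `⌈· / K⌉` are equal. -/
theorem eq_of_mod_eq_of_ceil_div_eq {K a b : ℕ} (hK : 0 < K) (hmod : a % K = b % K)
    (hceil : ⌈(a : ℝ) / (K : ℝ)⌉ = ⌈(b : ℝ) / (K : ℝ)⌉) : a = b := by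
  have hK' : (K : ℝ) ≠ 0 := by exact_mod_cast hK.ne'
  have hdiv : ∀ n : ℕ, (n : ℝ) / K = ((n % K : ℕ) : ℝ) / K + ((n / K : ℕ) : ℝ) := by
    intro n
    field_simp
    exact_mod_cast (Nat.mod_add_div n K).symm
  rw [hdiv a, hdiv b, hmod, Int.ceil_add_natCast, Int.ceil_add_natCast] at hceil
  have : a / K = b / K := by exact_mod_cast add_left_cancel hceil
  rw [← Nat.mod_add_div a K, ← Nat.mod_add_div b K, hmod, this]

theorem guessing_with_extra_side_information
    {𝒳 𝒴 𝒵 : Type*} [Fintype 𝒳] [Fintype 𝒴] [Fintype 𝒵]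
    (ρ : ℝ) (hρ : 0 < ρ)
    (p : 𝒳 → 𝒴 → ℝ) (hp0 : ∀ x y, 0 ≤ p x y) (hp1 : ∑ x : 𝒳, ∑ y : 𝒴, p x y = 1)
    (w : 𝒳 → 𝒴 → 𝒵 → ℝ) (hw0 : ∀ x y z, 0 ≤ w x y z) (hw1 : ∀ x y, ∑ z : 𝒵, w x y z = 1)
    (Gyz : 𝒴 × 𝒵 → 𝒳 → ℕ) (hGyz : IsGuess Gyz)
    (hGyzOpt : ∀ G : 𝒴 × 𝒵 → 𝒳 → ℕ, IsGuess G →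
      (∑ x : 𝒳, ∑ y : 𝒴, ∑ z : 𝒵, p x y * w x y z * (Gyz (y, z) x : ℝ) ^ ρ) ≤
        ∑ x : 𝒳, ∑ y : 𝒴, ∑ z : 𝒵, p x y * w x y z * (G (y, z) x : ℝ) ^ ρ)
    (Gy : 𝒴 → 𝒳 → ℕ) (hGy : IsGuess Gy)
    (hGyOpt : ∀ G : 𝒴 → 𝒳 → ℕ, IsGuess G →
      (∑ x : 𝒳, ∑ y : 𝒴, p x y * (Gy y x : ℝ) ^ ρ) ≤
        ∑ x : 𝒳, ∑ y : 𝒴, p x y * (G y x : ℝ) ^ ρ) :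
    ((∑ x : 𝒳, ∑ y : 𝒴,
        p x y * ((⌈(Gy y x : ℝ) / (Fintype.card 𝒵 : ℝ)⌉ : ℝ)) ^ ρ) ≤
      ∑ x : 𝒳, ∑ y : 𝒴, ∑ z : 𝒵, p x y * w x y z * (Gyz (y, z) x : ℝ) ^ ρ)
    ∧ (∀ f : 𝒳 × 𝒴 → 𝒵,
        (∀ x x' y, f (x, y) = f (x', y) →
          ⌈(Gy y x : ℝ) / (Fintype.card 𝒵 : ℝ)⌉ ≠ ⌈(Gy y x' : ℝ) / (Fintype.card 𝒵 : ℝ)⌉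
            ∨ x = x') →
        ∀ G' : 𝒴 × 𝒵 → 𝒳 → ℕ, IsGuess G' →
          (∀ G : 𝒴 × 𝒵 → 𝒳 → ℕ, IsGuess G →
            (∑ x : 𝒳, ∑ y : 𝒴, p x y * (G' (y, f (x, y)) x : ℝ) ^ ρ) ≤
              ∑ x : 𝒳, ∑ y : 𝒴, p x y * (G (y, f (x, y)) x : ℝ) ^ ρ) →
          (∑ x : 𝒳, ∑ y : 𝒴, p x y * (G' (y, f (x, y)) x : ℝ) ^ ρ) =
            ∑ x : 𝒳, ∑ y : 𝒴,
              p x y * ((⌈(Gy y x : ℝ) / (Fintype.card 𝒵 : ℝ)⌉ : ℝ)) ^ ρ)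
    ∧ (∃ f : 𝒳 × 𝒴 → 𝒵, ∀ x x' y, f (x, y) = f (x', y) →
        ⌈(Gy y x : ℝ) / (Fintype.card 𝒵 : ℝ)⌉ ≠ ⌈(Gy y x' : ℝ) / (Fintype.card 𝒵 : ℝ)⌉
          ∨ x = x') := by
  classical
  have hX : Nonempty 𝒳 := by
    by_contra h
    rw [not_nonempty_iff] at h
    simp at hp1
  have hY : Nonempty 𝒴 := by
    by_contra h
    rw [not_nonempty_iff] at h
    simp at hp1
  have hZ : Nonempty 𝒵 := by
    by_contra h
    rw [not_nonempty_iff] at h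
    simpa using hw1 hX.some hY.some
  have hK : 0 < Fintype.card 𝒵 := Fintype.card_pos
  have hφ : StrictMono fun n : ℕ => (n : ℝ) ^ ρ := fun a b hab =>
    Real.rpow_lt_rpow (Nat.cast_nonneg a) (by exact_mod_cast hab) hρ
  have hceil : ∀ x y, ((⌈(Gy y x : ℝ) / (Fintype.card 𝒵 : ℝ)⌉ : ℤ) : ℝ) =
      (⌈(Gy y x : ℝ) / (Fintype.card 𝒵 : ℝ)⌉₊ : ℝ) := fun x y =>
    (natCast_ceil_eq_intCast_ceil (by positivity)).symm
  have hanti : ∀ y x x', Gy y x ≤ Gy y x' → p x' y ≤ p x y := fun y x x' =>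
    weight_le_of_guess_le (fun x => p x y) (hGy y) hφ
      (sum_le_sum_of_optimal_guess p (fun n => (n : ℝ) ^ ρ) hGy hGyOpt y)
  have lower : ∀ G : 𝒴 × 𝒵 → 𝒳 → ℕ, IsGuess G → ∀ ζ : 𝒳 → 𝒴 → 𝒵,
      ∑ x, ∑ y, p x y * (⌈(Gy y x : ℝ) / (Fintype.card 𝒵 : ℝ)⌉ : ℝ) ^ ρ ≤
        ∑ x, ∑ y, p x y * (G (y, ζ x y) x : ℝ) ^ ρ := by
    intro G hG ζ
    rw [Finset.sum_comm, Finset.sum_comm (γ := 𝒳)]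
    refine Finset.sum_le_sum fun y _ => ?_
    simp_rw [hceil]
    exact sum_ceil_div_le_sum_selected_guess (fun x => p x y) (fun x => hp0 x y) (hGy y)
      (hanti y) (g := fun z => G (y, z)) (fun z => hG (y, z)) (fun x => ζ x y) hφ.monotone
  refine ⟨?_, ?_, ?_⟩
  · have hmin : ∀ x y, ∃ ζ, ∀ z, Gyz (y, ζ) x ≤ Gyz (y, z) x := fun x y =>
      Finite.exists_min fun z => Gyz (y, z) x
    choose ζ hζ using hmin
    refine (lower Gyz hGyz ζ).trans
      (Finset.sum_le_sum fun x _ => Finset.sum_le_sum fun y _ => ?_)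
    calc p x y * (Gyz (y, ζ x y) x : ℝ) ^ ρ
        = ∑ z, p x y * w x y z * (Gyz (y, ζ x y) x : ℝ) ^ ρ := by
          rw [← Finset.sum_mul, ← Finset.mul_sum, hw1, mul_one]
      _ ≤ _ := Finset.sum_le_sum fun z _ =>
          mul_le_mul_of_nonneg_left (hφ.monotone (hζ x y z)) (mul_nonneg (hp0 x y) (hw0 x y z))
  · intro f hf G' hG' hG'opt
    refine le_antisymm ?_ (lower G' hG' fun x y => f (x, y))
    have hex : ∀ v : 𝒴 × 𝒵, ∃ g : 𝒳 → ℕ,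
        Set.BijOn g Set.univ (Set.Icc 1 (Fintype.card 𝒳)) ∧
          ∀ x ∈ Finset.univ.filter fun x => f (x, v.1) = v.2,
            g x = ⌈(Gy v.1 x : ℝ) / (Fintype.card 𝒵 : ℝ)⌉₊ := by
      rintro ⟨y, z⟩
      refine exists_bijOn_extending _ _ (fun x _ => ?_) fun x hx x' hx' h => ?_
      · obtain ⟨h1, h2⟩ := (hGy y).mapsTo (Set.mem_univ x)
        refine ⟨Nat.ceil_pos.2 (div_pos (by exact_mod_cast h1) (by exact_mod_cast hK)), ?_⟩
        rw [natCeil_div_le_iff hK]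
        exact h2.trans (Nat.le_mul_of_pos_right _ hK)
      · simp only [Finset.coe_filter, Finset.mem_univ, true_and, Set.mem_ofPred_eq] at hx hx'
        refine (hf x x' y (hx.trans hx'.symm)).resolve_left (not_not.2 ?_)
        have : (⌈(Gy y x : ℝ) / (Fintype.card 𝒵 : ℝ)⌉ : ℝ) =
            ⌈(Gy y x' : ℝ) / (Fintype.card 𝒵 : ℝ)⌉ := by
          rw [hceil, hceil]
          exact_mod_cast h
        exact_mod_cast this
    choose G hG hGc using hex
    refine (hG'opt G hG).trans (le_of_eq ?_)
    refine Finset.sum_congr rfl fun x _ => Finset.sum_congr rfl fun y _ => ?_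
    rw [hGc (y, f (x, y)) x (by simp), hceil]
  · refine ⟨fun v => (Fintype.equivFin 𝒵).symm
      ⟨Gy v.2 v.1 % Fintype.card 𝒵, Nat.mod_lt _ hK⟩, fun x x' y h => ?_⟩
    rw [or_iff_not_imp_left, not_not]
    intro hc
    have hmod : Gy y x % Fintype.card 𝒵 = Gy y x' % Fintype.card 𝒵 := by simpa using h
    exact (hGy y).injOn (Set.mem_univ _) (Set.mem_univ _)
      (eq_of_mod_eq_of_ceil_div_eq hK hmod hc)
end
end

section
/- Given a finite set 𝒵, there exists a mapping f : 𝒳×𝒴 → 𝒵 such that, with Z = f(X,Y), min over guessing functions G(·|Y,Z) of E[G(X|Y,Z)^ρ] < 1 + 2^ρ |𝒵|^{−ρ} · (min over guessing functions G(·|Y) of E[G(X|Y)^ρ]). Conversely, for every random variable Z taking values in 𝒵 (drawn according to an arbitrary conditional PMF given (X,Y)), min over guessing functions G(·|Y,Z) of E[G(X|Y,Z)^ρ] ≥ max( |𝒵|^{−ρ} · min over guessing functions G(·|Y) of E[G(X|Y)^ρ], 1 ). -/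
open scoped BigOperators

noncomputable section

/-- A map that is injective on each `S v` with values in `{1, …, |X|}` extends to a guessing
function. -/
theorem exists_isGuess_extending {X V : Type*} [Fintype X] (S : V → Set X) (h : V → X → ℕ)
    (hmaps : ∀ v, ∀ x ∈ S v, h v x ∈ Set.Icc 1 (Fintype.card X))
    (hinj : ∀ v, Set.InjOn (h v) (S v)) :
    ∃ G : V → X → ℕ, IsGuess G ∧ ∀ v, ∀ x ∈ S v, G v x = h v x := by
  have key (v : V) : ∃ g : X ≃ Finset.Icc 1 (Fintype.card X), ∀ x ∈ S v, (g x : ℕ) = h v x :=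
    Set.MapsTo.exists_equiv_extend_of_card_eq (by simp)
      (fun x hx => by simpa using hmaps v x hx) (hinj v)
  choose g hg using key
  refine ⟨fun v x => g v x, fun v => ⟨fun x _ => ?_, fun x _ x' _ hxx' => ?_, fun n hn => ?_⟩, hg⟩
  · exact Finset.mem_Icc.mp (g v x).2
  · exact (g v).injective (Subtype.ext hxx')
  · exact ⟨(g v).symm ⟨n, by simpa using hn⟩, trivial, by simp⟩

theorem exists_isGuess (X V : Type*) [Fintype X] : ∃ G : V → X → ℕ, IsGuess G := by
  obtain ⟨G, hG, -⟩ := exists_isGuess_extending (X := X) (V := V) (fun _ => ∅) (fun _ _ => 0)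
    (by simp) (by simp)
  exact ⟨G, hG⟩

theorem finite_setOf_isGuess (X V : Type*) [Fintype X] [Finite V] :
    {G : V → X → ℕ | IsGuess G}.Finite := by
  refine (Set.Finite.pi' fun _ : V => Set.Finite.pi' fun _ : X =>
    Set.finite_Icc 1 (Fintype.card X)).subset ?_
  exact fun G hG v x => (hG v).mapsTo (Set.mem_univ x)

/-- Guessing in nondecreasing order of `h`, the rank of `x` is at most the number of points whose
`h`-value does not exceed that of `x`. -/
theorem exists_isGuess_le_card {X V : Type*} [Fintype X] (h : V → X → ℕ) :
    ∃ G : V → X → ℕ, IsGuess G ∧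
      ∀ v x, G v x ≤ (Finset.univ.filter fun x' => h v x' ≤ h v x).card := by
  let e := Fintype.equivFin X
  let σ (v : V) : Equiv.Perm (Fin (Fintype.card X)) := Tuple.sort (h v ∘ e.symm)
  have hσ (v : V) : Monotone ((h v ∘ e.symm) ∘ σ v) := Tuple.monotone_sort _
  refine ⟨fun v x => ((σ v).symm (e x) : ℕ) + 1,
    fun v => ⟨fun x _ => ?_, fun x _ x' _ hxx' => ?_, fun n hn => ?_⟩, fun v x => ?_⟩
  · have := ((σ v).symm (e x)).2
    simp only [Set.mem_Icc]
    omega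
  · simpa [Fin.val_inj] using hxx'
  · obtain ⟨h1, h2⟩ := hn
    refine ⟨e.symm (σ v ⟨n - 1, by omega⟩), trivial, ?_⟩
    simp only [Equiv.apply_symm_apply, Equiv.symm_apply_apply]
    omega
  · refine (Fin.card_Iic ((σ v).symm (e x))).symm.trans_le ?_
    refine Finset.card_le_card_of_injOn (fun i => e.symm (σ v i)) (fun i hi => ?_)
      (fun i _ j _ hij => by simpa using hij)
    have hi' : i ≤ (σ v).symm (e x) := by simpa using hi
    simpa using hσ v hi'

/-- If `h v x` is the least rank of `x` among `|Z|` guessing functions, then `x` can be guessed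
from `v` alone within `|Z| * h v x` attempts. -/
theorem exists_isGuess_le_card_mul {X V Z : Type*} [Fintype X] [Fintype Z] [Nonempty Z]
    {G : V × Z → X → ℕ} (hG : IsGuess G) :
    ∃ G' : V → X → ℕ, IsGuess G' ∧ ∀ v z x, G' v x ≤ Fintype.card Z * G (v, z) x := by
  choose m hm using fun (v : V) (x : X) => Finite.exists_min fun z : Z => G (v, z) x
  obtain ⟨G', hG', hle⟩ := exists_isGuess_le_card fun v x => G (v, m v x) x
  refine ⟨G', hG', fun v z x => ?_⟩
  calc G' v x ≤ _ := hle v x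
    _ ≤ ((Finset.univ : Finset Z) ×ˢ Finset.Icc 1 (G (v, m v x) x)).card := by
      refine Finset.card_le_card_of_injOn (fun x' => (m v x', G (v, m v x') x')) ?_ ?_
      · intro x' hx'
        have h1 := ((hG (v, m v x')).mapsTo (Set.mem_univ x')).1
        have h2 : G (v, m v x') x' ≤ G (v, m v x) x := by simpa using hx'
        simp [h1, h2]
      · intro a _ b _ hab
        simp only [Prod.mk.injEq] at hab
        refine (hG (v, m v a)).injOn trivial trivial (hab.2.trans ?_)
        rw [hab.1]
    _ = Fintype.card Z * G (v, m v x) x := by simp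
    _ ≤ Fintype.card Z * G (v, z) x := Nat.mul_le_mul_left _ (hm v x z)

/-- From a guessing function given `V` one obtains side information with values in `Z` that
reduces the rank `n` to `⌈n / |Z|⌉ = (n - 1) / |Z| + 1`. -/
theorem exists_sideInfo {X V Z : Type*} [Fintype X] [Fintype Z] [Nonempty Z]
    {G : V → X → ℕ} (hG : IsGuess G) :
    ∃ (f : X × V → Z) (G' : V × Z → X → ℕ), IsGuess G' ∧
      ∀ v x, G' (v, f (x, v)) x = (G v x - 1) / Fintype.card Z + 1 := by
  have hpos : 0 < Fintype.card Z := Fintype.card_pos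
  let f : X × V → Z := fun a =>
    (Fintype.equivFin Z).symm ⟨(G a.2 a.1 - 1) % Fintype.card Z, Nat.mod_lt _ hpos⟩
  have hmem (v : V) (x : X) : 1 ≤ G v x ∧ G v x ≤ Fintype.card X :=
    (hG v).mapsTo (Set.mem_univ x)
  obtain ⟨G', hG', h⟩ := exists_isGuess_extending (V := V × Z) (fun a => {x | f (x, a.1) = a.2})
    (fun a x => (G a.1 x - 1) / Fintype.card Z + 1)
    (fun a x _ => by
      obtain ⟨h1, h2⟩ := hmem a.1 x
      have hdiv := Nat.div_le_self (G a.1 x - 1) (Fintype.card Z)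
      exact ⟨Nat.le_add_left 1 _, by
        generalize (G a.1 x - 1) / Fintype.card Z = q at *
        omega⟩)
    (by
      rintro ⟨v, z⟩ a ha b hb hab
      have hf : f (a, v) = f (b, v) := Eq.trans ha (Eq.symm hb)
      have hmod : (G v a - 1) % Fintype.card Z = (G v b - 1) % Fintype.card Z := by
        simpa [f] using hf
      have hdiv : (G v a - 1) / Fintype.card Z = (G v b - 1) / Fintype.card Z := by
        simpa using hab
      have heq : G v a - 1 = G v b - 1 := by
        rw [← Nat.div_add_mod (G v a - 1) (Fintype.card Z), hmod, hdiv, Nat.div_add_mod]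
      have h1 := hmem v a
      have h2 := hmem v b
      exact (hG v).injOn trivial trivial (by omega))
  exact ⟨f, G', hG', fun v x => h (v, f (x, v)) x rfl⟩

theorem ceil_div_rpow_lt {ρ : ℝ} (hρ : 0 < ρ) {m n : ℕ} (hm : 0 < m) (hn : 1 ≤ n) :
    (((n - 1) / m + 1 : ℕ) : ℝ) ^ ρ < 1 + (2 : ℝ) ^ ρ * (m : ℝ) ^ (-ρ) * (n : ℝ) ^ ρ := by
  have hm' : (0 : ℝ) < m := by exact_mod_cast hm
  have hn' : (0 : ℝ) < n := by exact_mod_cast hn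
  have hprod : (2 : ℝ) ^ ρ * (m : ℝ) ^ (-ρ) * (n : ℝ) ^ ρ = (2 * n / m : ℝ) ^ ρ := by
    rw [Real.div_rpow (by positivity) hm'.le, Real.mul_rpow (by positivity) hn'.le,
      Real.rpow_neg hm'.le]
    field_simp
  rw [hprod]
  rcases Nat.eq_zero_or_pos ((n - 1) / m) with h0 | h1
  · have : (0 : ℝ) < (2 * n / m : ℝ) ^ ρ := by positivity
    simp [h0, this]
  · have hle : (((n - 1) / m + 1 : ℕ) : ℝ) ≤ 2 * n / m := by
      rw [le_div_iff₀ hm']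
      have hmul := Nat.div_mul_le_self (n - 1) m
      have : ((n - 1) / m + 1) * m ≤ 2 * n := by nlinarith [Nat.sub_le n 1]
      exact_mod_cast this
    have := Real.rpow_le_rpow (by positivity) hle hρ.le
    linarith

theorem sum_sum_mul_lt_of_lt {X Y : Type*} [Fintype X] [Fintype Y] {p a b : X → Y → ℝ}
    (hp0 : ∀ x y, 0 ≤ p x y) (hp1 : ∑ x, ∑ y, p x y = 1) (hab : ∀ x y, a x y < b x y) :
    ∑ x, ∑ y, p x y * a x y < ∑ x, ∑ y, p x y * b x y := by
  obtain ⟨x, y, hxy⟩ : ∃ x y, p x y ≠ 0 := by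
    by_contra! h
    simp [h] at hp1
  have hle (x y) : p x y * a x y ≤ p x y * b x y :=
    mul_le_mul_of_nonneg_left (hab x y).le (hp0 x y)
  refine Finset.sum_lt_sum (fun x _ => Finset.sum_le_sum fun y _ => hle x y)
    ⟨x, Finset.mem_univ x, Finset.sum_lt_sum (fun y _ => hle x y) ⟨y, Finset.mem_univ y, ?_⟩⟩
  exact mul_lt_mul_of_pos_left (hab x y) ((hp0 x y).lt_of_ne' hxy)

theorem bddBelow_guessing_moments {X Y V : Type*} [Fintype X] [Fintype Y] {ρ : ℝ}
    {p : X → Y → ℝ} (hp0 : ∀ x y, 0 ≤ p x y) (s : X → Y → V) :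
    BddBelow {r : ℝ | ∃ G : V → X → ℕ, IsGuess G ∧
      r = ∑ x, ∑ y, p x y * (G (s x y) x : ℝ) ^ ρ} := by
  refine ⟨0, ?_⟩
  rintro r ⟨G, -, rfl⟩
  exact Finset.sum_nonneg fun x _ => Finset.sum_nonneg fun y _ =>
    mul_nonneg (hp0 x y) (by positivity)

theorem exists_isGuess_sInf_eq {X Y : Type*} [Fintype X] [Fintype Y] (ρ : ℝ) (p : X → Y → ℝ) :
    ∃ G : Y → X → ℕ, IsGuess G ∧
      sInf {r : ℝ | ∃ G : Y → X → ℕ, IsGuess G ∧ r = ∑ x, ∑ y, p x y * (G y x : ℝ) ^ ρ} =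
        ∑ x, ∑ y, p x y * (G y x : ℝ) ^ ρ := by
  obtain ⟨G₀, hG₀⟩ := exists_isGuess X Y
  have hne : {r : ℝ | ∃ G : Y → X → ℕ, IsGuess G ∧
      r = ∑ x, ∑ y, p x y * (G y x : ℝ) ^ ρ}.Nonempty := ⟨_, G₀, hG₀, rfl⟩
  refine hne.csInf_mem (((finite_setOf_isGuess X Y).image
    fun G => ∑ x, ∑ y, p x y * (G y x : ℝ) ^ ρ).subset ?_)
  rintro r ⟨G, hG, rfl⟩
  exact ⟨G, hG, rfl⟩

theorem side_information_improves_guessing_by_card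
    {𝒳 𝒴 𝒵 : Type*} [Fintype 𝒳] [Fintype 𝒴] [Fintype 𝒵] [Nonempty 𝒵]
    (ρ : ℝ) (hρ : 0 < ρ)
    (p : 𝒳 → 𝒴 → ℝ) (hp0 : ∀ x y, 0 ≤ p x y) (hp1 : ∑ x : 𝒳, ∑ y : 𝒴, p x y = 1) :
    (∃ f : 𝒳 × 𝒴 → 𝒵,
      sInf {r : ℝ | ∃ G : 𝒴 × 𝒵 → 𝒳 → ℕ, IsGuess G ∧
          r = ∑ x : 𝒳, ∑ y : 𝒴, p x y * (G (y, f (x, y)) x : ℝ) ^ ρ}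
        < 1 + (2 : ℝ) ^ ρ * (Fintype.card 𝒵 : ℝ) ^ (-ρ) *
            sInf {r : ℝ | ∃ G : 𝒴 → 𝒳 → ℕ, IsGuess G ∧
              r = ∑ x : 𝒳, ∑ y : 𝒴, p x y * (G y x : ℝ) ^ ρ})
    ∧ (∀ w : 𝒳 → 𝒴 → 𝒵 → ℝ, (∀ x y z, 0 ≤ w x y z) → (∀ x y, ∑ z : 𝒵, w x y z = 1) →
        sInf {r : ℝ | ∃ G : 𝒴 × 𝒵 → 𝒳 → ℕ, IsGuess G ∧
            r = ∑ x : 𝒳, ∑ y : 𝒴, ∑ z : 𝒵, p x y * w x y z * (G (y, z) x : ℝ) ^ ρ}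
          ≥ max ((Fintype.card 𝒵 : ℝ) ^ (-ρ) *
              sInf {r : ℝ | ∃ G : 𝒴 → 𝒳 → ℕ, IsGuess G ∧
                r = ∑ x : 𝒳, ∑ y : 𝒴, p x y * (G y x : ℝ) ^ ρ}) 1) := by
  have hcard : (0 : ℝ) < Fintype.card 𝒵 := by exact_mod_cast Fintype.card_pos
  constructor
  · obtain ⟨G, hG, hopt⟩ := exists_isGuess_sInf_eq ρ p
    obtain ⟨f, G', hG', hGG'⟩ := exists_sideInfo (Z := 𝒵) hG
    refine ⟨f, ?_⟩
    rw [hopt]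
    refine (csInf_le (bddBelow_guessing_moments hp0 fun x y => (y, f (x, y)))
      ⟨G', hG', rfl⟩).trans_lt ?_
    refine (sum_sum_mul_lt_of_lt (p := p)
      (b := fun x y => 1 + (2 : ℝ) ^ ρ * (Fintype.card 𝒵 : ℝ) ^ (-ρ) * (G y x : ℝ) ^ ρ)
      hp0 hp1 fun x y => ?_).trans_eq ?_
    · rw [hGG' y x]
      exact ceil_div_rpow_lt hρ Fintype.card_pos ((hG y).mapsTo (Set.mem_univ x)).1
    · simp only [mul_add, mul_one, Finset.sum_add_distrib, hp1, Finset.mul_sum]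
      simp only [mul_left_comm]
  · intro w hw0 hw1
    obtain ⟨G₀, hG₀⟩ := exists_isGuess 𝒳 (𝒴 × 𝒵)
    refine le_csInf ⟨_, G₀, hG₀, rfl⟩ ?_
    rintro r ⟨G, hG, rfl⟩
    have average_le (c : 𝒳 → 𝒴 → ℝ) (hc : ∀ x y z, c x y ≤ (G (y, z) x : ℝ) ^ ρ) :
        ∑ x, ∑ y, p x y * c x y ≤
          ∑ x, ∑ y, ∑ z, p x y * w x y z * (G (y, z) x : ℝ) ^ ρ := by
      refine Finset.sum_le_sum fun x _ => Finset.sum_le_sum fun y _ => ?_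
      calc p x y * c x y = ∑ z, p x y * w x y z * c x y := by
            rw [← Finset.sum_mul, ← Finset.mul_sum, hw1, mul_one]
        _ ≤ _ := Finset.sum_le_sum fun z _ =>
            mul_le_mul_of_nonneg_left (hc x y z) (mul_nonneg (hp0 x y) (hw0 x y z))
    refine max_le ?_ ?_
    · obtain ⟨G', hG', hle⟩ := exists_isGuess_le_card_mul hG
      calc (Fintype.card 𝒵 : ℝ) ^ (-ρ) * _
          ≤ (Fintype.card 𝒵 : ℝ) ^ (-ρ) * ∑ x, ∑ y, p x y * (G' y x : ℝ) ^ ρ :=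
            mul_le_mul_of_nonneg_left
              (csInf_le (bddBelow_guessing_moments hp0 fun _ y => y) ⟨G', hG', rfl⟩)
              (by positivity)
        _ = ∑ x, ∑ y, p x y * ((Fintype.card 𝒵 : ℝ) ^ (-ρ) * (G' y x : ℝ) ^ ρ) := by
            simp only [Finset.mul_sum, mul_left_comm]
        _ ≤ _ := average_le _ fun x y z => by
            have h : (G' y x : ℝ) ≤ Fintype.card 𝒵 * G (y, z) x := by exact_mod_cast hle y z x
            rw [Real.rpow_neg hcard.le, inv_mul_le_iff₀ (by positivity),
              ← Real.mul_rpow hcard.le (by positivity)]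
            exact Real.rpow_le_rpow (by positivity) h hρ.le
    · have := average_le (fun _ _ => 1) fun x y z =>
        Real.one_le_rpow (by exact_mod_cast ((hG (y, z)).mapsTo (Set.mem_univ x)).1) hρ.le
      simpa [hp1] using this
end
end

section
/- Let 𝒵 be a finite set. For every stochastic task-encoder for X given Y with description alphabet 𝒵, with description Z and associated decoding lists {L^y_z}, there exists a guessing function G(·|Y) for X given Y satisfying E[G(X|Y)^ρ] ≤ |𝒵|^ρ · E[|L^Y_Z|^ρ]. -/
open scoped BigOperators

noncomputable section

/-- Listing the elements of `X` in increasing order of `f` puts `x` at a position which is at most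
the number of `x'` with `f x' ≤ f x`. -/
theorem exists_bijOn_le_card_filter_le {X α : Type*} [Fintype X] [LinearOrder α] (f : X → α) :
    ∃ g : X → ℕ, Set.BijOn g Set.univ (Set.Icc 1 (Fintype.card X)) ∧
      ∀ x, g x ≤ (Finset.univ.filter fun x' => f x' ≤ f x).card := by
  classical
  let key : X → α ×ₗ Fin (Fintype.card X) := fun x => toLex (f x, Fintype.equivFin X x)
  have key_inj : Function.Injective key := fun a b h => by
    have h' : (f a, Fintype.equivFin X a) = (f b, Fintype.equivFin X b) := toLex.injective h
    exact (Fintype.equivFin X).injective (Prod.ext_iff.1 h').2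
  let g : X → ℕ := fun x => (Finset.univ.filter fun x' => key x' ≤ key x).card
  have g_lt : ∀ a b, key a < key b → g a < g b := fun a b h => by
    refine Finset.card_lt_card (Finset.ssubset_iff_of_subset (fun c hc => ?_) |>.2 ⟨b, ?_, ?_⟩)
    · simp only [Finset.mem_filter, Finset.mem_univ, true_and] at hc ⊢
      exact hc.trans h.le
    · simp
    · simpa using h
  have g_inj : Set.InjOn g (Finset.univ : Finset X) := fun a _ b _ h => by
    rcases lt_trichotomy (key a) (key b) with hab | hab | hab
    · exact absurd h (g_lt _ _ hab).ne
    · exact key_inj hab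
    · exact absurd h (g_lt _ _ hab).ne'
  have g_maps : Set.MapsTo g (Finset.univ : Finset X)
      (Finset.Icc 1 (Fintype.card X) : Finset ℕ) := fun a _ => by
    rw [Finset.mem_coe, Finset.mem_Icc]
    exact ⟨Finset.card_pos.2 ⟨a, by simp⟩, Finset.card_le_univ _⟩
  have g_surj := Finset.surjOn_of_injOn_of_card_le g g_maps g_inj (by simp)
  refine ⟨g, ?_, fun x => Finset.card_le_card fun c hc => ?_⟩
  · rw [← Finset.coe_univ, ← Finset.coe_Icc]
    exact ⟨g_maps, g_inj, g_surj⟩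
  · simp only [Finset.mem_filter, Finset.mem_univ, true_and] at hc ⊢
    exact Prod.Lex.monotone_fst _ _ hc

/-- Given lists `{x | R x z}` indexed by `z : Z`, the elements of `X` can be ordered so that every
`x` comes at a position at most `|Z|` times the size of any list containing it. -/
theorem exists_bijOn_le_card_mul_card_filter {X Z : Type*} [Fintype X] [Fintype Z]
    (R : X → Z → Prop) [∀ z, DecidablePred fun x => R x z] :
    ∃ g : X → ℕ, Set.BijOn g Set.univ (Set.Icc 1 (Fintype.card X)) ∧
      ∀ x z, R x z → g x ≤ Fintype.card Z * (Finset.univ.filter fun x' => R x' z).card := by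
  classical
  let c : Z → ℕ := fun z => (Finset.univ.filter fun x' => R x' z).card
  obtain ⟨g, hg, hle⟩ := exists_bijOn_le_card_filter_le
    fun x => (Finset.univ.filter (R x)).inf fun z => (c z : ℕ∞)
  refine ⟨g, hg, fun x z hxz => (hle x).trans ?_⟩
  calc _ ≤ ((Finset.univ.filter fun z' => c z' ≤ c z).biUnion
        fun z' => Finset.univ.filter fun x' => R x' z').card := by
        refine Finset.card_le_card fun x' hx' => ?_
        have hx : (Finset.univ.filter (R x')).inf (fun z => (c z : ℕ∞)) ≤ c z :=
          (Finset.mem_filter.1 hx').2.trans (Finset.inf_le (by simpa using hxz))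
        obtain ⟨z', hz', hc⟩ := (Finset.inf_le_iff (ENat.natCast_lt_top _)).1 hx
        simp only [Finset.mem_biUnion, Finset.mem_filter, Finset.mem_univ, true_and] at hz' ⊢
        exact ⟨z', by exact_mod_cast hc, hz'⟩
    _ ≤ (Finset.univ.filter fun z' => c z' ≤ c z).card * c z :=
        Finset.card_biUnion_le_card_mul _ _ _ fun z' hz' => (Finset.mem_filter.1 hz').2
    _ ≤ _ := Nat.mul_le_mul_right _ (Finset.card_le_univ _)

theorem task_encoder_induces_guessing_function
    {𝒳 𝒴 𝒵 : Type*} [Fintype 𝒳] [Fintype 𝒴] [Fintype 𝒵]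
    (ρ : ℝ) (hρ : 0 < ρ)
    (p : 𝒳 → 𝒴 → ℝ) (hp0 : ∀ x y, 0 ≤ p x y) (hp1 : ∑ x : 𝒳, ∑ y : 𝒴, p x y = 1)
    (w : 𝒳 → 𝒴 → 𝒵 → ℝ) (hw0 : ∀ x y z, 0 ≤ w x y z) (hw1 : ∀ x y, ∑ z : 𝒵, w x y z = 1) :
    ∃ G : 𝒴 → 𝒳 → ℕ, IsGuess G ∧
      (∑ x : 𝒳, ∑ y : 𝒴, p x y * (G y x : ℝ) ^ ρ) ≤
        (Fintype.card 𝒵 : ℝ) ^ ρ *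
          ∑ x : 𝒳, ∑ y : 𝒴, ∑ z : 𝒵, p x y * w x y z *
            (((Finset.univ.filter fun x' : 𝒳 => 0 < p x' y * w x' y z).card : ℝ)) ^ ρ := by
  choose G hG hle using fun y =>
    exists_bijOn_le_card_mul_card_filter fun (x : 𝒳) (z : 𝒵) => 0 < p x y * w x y z
  refine ⟨G, hG, ?_⟩
  simp_rw [Finset.mul_sum]
  refine Finset.sum_le_sum fun x _ => Finset.sum_le_sum fun y _ => ?_
  calc p x y * (G y x : ℝ) ^ ρ = ∑ z : 𝒵, p x y * w x y z * (G y x : ℝ) ^ ρ := by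
        rw [← Finset.sum_mul, ← Finset.mul_sum, hw1, mul_one]
    _ ≤ _ := Finset.sum_le_sum fun z _ => ?_
  rcases (mul_nonneg (hp0 x y) (hw0 x y z)).eq_or_lt with h | h
  · simp [← h]
  · rw [mul_left_comm, ← Real.mul_rpow (Nat.cast_nonneg _) (Nat.cast_nonneg _)]
    refine mul_le_mul_of_nonneg_left ?_ h.le
    refine Real.rpow_le_rpow (Nat.cast_nonneg _) ?_ hρ.le
    exact_mod_cast hle y x z h
end
end

section
/- Let 𝒵 be a finite set, let G(·|Y) be any guessing function for X given Y, and let ω be a positive integer with ω ≤ |𝒳| and |𝒵| ≥ ω(1 + ⌊log⌈|𝒳|/ω⌉⌋). Then there exists a deterministic task-encoder for X given Y with description alphabet 𝒵 (i.e. a stochastic task-encoder whose conditional PMF is {0,1}-valued) whose associated decoding lists satisfy E[|L^Y_Z|^ρ] ≤ E[⌈G(X|Y)/ω⌉^ρ]. -/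
open scoped BigOperators

noncomputable section

/-- Numbers `g ≥ 1` are determined by the residue of `g - 1` modulo `ω` and the block index
`(g - 1) / ω + 1`; hence at most `(g - 1) / ω + 1` of them share both the residue and the
binary order of magnitude of the block index with `g`. -/
lemma card_le_of_mod_eq_of_log_eq {ω g : ℕ} (S : Finset ℕ)
    (hpos : ∀ n ∈ S, 1 ≤ n) (hmod : ∀ n ∈ S, (n - 1) % ω = (g - 1) % ω)
    (hlog : ∀ n ∈ S, Nat.log 2 ((n - 1) / ω + 1) = Nat.log 2 ((g - 1) / ω + 1)) :
    S.card ≤ (g - 1) / ω + 1 := by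
  set s := Nat.log 2 ((g - 1) / ω + 1)
  have hmaps : ∀ n ∈ S, (n - 1) / ω + 1 ∈ Finset.Ico (2 ^ s) (2 ^ (s + 1)) := by
    intro n hn
    rw [Finset.mem_Ico, ← hlog n hn]
    exact ⟨Nat.pow_log_le_self 2 (Nat.succ_ne_zero _), Nat.lt_pow_succ_log_self one_lt_two _⟩
  have hinj : Set.InjOn (fun n => (n - 1) / ω + 1) (S : Set ℕ) := by
    intro a ha b hb hab
    have hdiv : (a - 1) / ω = (b - 1) / ω := Nat.succ_injective hab
    have h : a - 1 = b - 1 := by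
      rw [← Nat.div_add_mod (a - 1) ω, ← Nat.div_add_mod (b - 1) ω, hdiv, hmod a ha, hmod b hb]
    have := hpos a ha
    have := hpos b hb
    omega
  calc S.card ≤ (Finset.Ico (2 ^ s) (2 ^ (s + 1))).card :=
        Finset.card_le_card_of_injOn _ hmaps hinj
    _ = 2 ^ s := by rw [Nat.card_Ico, pow_succ]; omega
    _ ≤ (g - 1) / ω + 1 := Nat.pow_log_le_self 2 (Nat.succ_ne_zero _)

lemma pred_div_succ_le_ceil {g ω : ℕ} (hg : 1 ≤ g) (hω : 0 < ω) :
    (((g - 1) / ω + 1 : ℕ) : ℝ) ≤ (⌈(g : ℝ) / (ω : ℝ)⌉ : ℝ) := by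
  have h : (((g - 1) / ω : ℕ) : ℤ) < ⌈(g : ℝ) / (ω : ℝ)⌉ := by
    rw [Int.lt_ceil, lt_div_iff₀ (by exact_mod_cast hω)]
    have := Nat.div_mul_le_self (g - 1) ω
    exact_mod_cast (by omega : (g - 1) / ω * ω < g)
  have h' : (((g - 1) / ω + 1 : ℕ) : ℤ) ≤ ⌈(g : ℝ) / (ω : ℝ)⌉ := by
    rw [Nat.cast_succ]
    exact Int.add_one_le_iff.mpr h
  rw [← Int.cast_natCast (R := ℝ)]
  exact Int.cast_le.mpr h'

theorem guessing_function_induces_task_encoder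
    {𝒳 𝒴 𝒵 : Type*} [Fintype 𝒳] [Fintype 𝒴] [Fintype 𝒵]
    (ρ : ℝ) (hρ : 0 < ρ)
    (p : 𝒳 → 𝒴 → ℝ) (hp0 : ∀ x y, 0 ≤ p x y) (hp1 : ∑ x : 𝒳, ∑ y : 𝒴, p x y = 1)
    (G : 𝒴 → 𝒳 → ℕ) (hG : IsGuess G)
    (ω : ℕ) (hω : 0 < ω) (hω' : ω ≤ Fintype.card 𝒳)
    (hZ : ω * (1 + Nat.log 2 ((Fintype.card 𝒳 + ω - 1) / ω)) ≤ Fintype.card 𝒵) :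
    ∃ w : 𝒳 → 𝒴 → 𝒵 → ℝ,
      (∀ x y z, 0 ≤ w x y z) ∧ (∀ x y, ∑ z : 𝒵, w x y z = 1) ∧
      (∀ x y z, w x y z = 0 ∨ w x y z = 1) ∧
      (∑ x : 𝒳, ∑ y : 𝒴, ∑ z : 𝒵, p x y * w x y z *
          (((Finset.univ.filter fun x' : 𝒳 => 0 < p x' y * w x' y z).card : ℝ)) ^ ρ) ≤
        ∑ x : 𝒳, ∑ y : 𝒴, p x y * ((⌈(G y x : ℝ) / (ω : ℝ)⌉ : ℝ)) ^ ρ := by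
  classical
  set N := 1 + Nat.log 2 ((Fintype.card 𝒳 + ω - 1) / ω) with hN
  obtain ⟨e⟩ : Nonempty (Fin ω × Fin N ↪ 𝒵) :=
    Function.Embedding.nonempty_of_card_le (by simpa using hZ)
  have hmem : ∀ y x, 1 ≤ G y x ∧ G y x ≤ Fintype.card 𝒳 := fun y x =>
    (hG y).mapsTo (Set.mem_univ x)
  have hlt : ∀ x y, Nat.log 2 ((G y x - 1) / ω + 1) < N := by
    intro x y
    have hle : (G y x - 1) / ω + 1 ≤ (Fintype.card 𝒳 + ω - 1) / ω := by
      rw [← Nat.add_div_right _ hω]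
      have := hmem y x
      exact Nat.div_le_div_right (by omega)
    have := Nat.log_mono_right (b := 2) hle
    omega
  let f : 𝒳 → 𝒴 → 𝒵 := fun x y =>
    e (⟨(G y x - 1) % ω, Nat.mod_lt _ hω⟩, ⟨Nat.log 2 ((G y x - 1) / ω + 1), hlt x y⟩)
  refine ⟨fun x y z => if f x y = z then 1 else 0, fun x y z => by dsimp only; split_ifs <;> simp,
    fun x y => by simp, fun x y z => by dsimp only; split_ifs <;> simp, ?_⟩
  dsimp only
  refine Finset.sum_le_sum fun x _ => Finset.sum_le_sum fun y _ => ?_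
  rw [Finset.sum_eq_single (f x y) (fun z _ hz => by simp [hz.symm]) (by simp), if_pos rfl,
    mul_one]
  refine mul_le_mul_of_nonneg_left (Real.rpow_le_rpow (Nat.cast_nonneg _) ?_ hρ.le) (hp0 x y)
  refine le_trans ?_ (pred_div_succ_le_ceil (hmem y x).1 hω)
  set L := Finset.univ.filter fun x' : 𝒳 => 0 < p x' y * (if f x' y = f x y then (1 : ℝ) else 0)
  have hL : ∀ x' ∈ L, (G y x' - 1) % ω = (G y x - 1) % ω ∧
      Nat.log 2 ((G y x' - 1) / ω + 1) = Nat.log 2 ((G y x - 1) / ω + 1) := by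
    intro x' hx'
    have hf : f x' y = f x y := by
      by_contra h
      simp [L, h] at hx'
    simpa [Prod.ext_iff, Fin.ext_iff] using e.injective hf
  have hGinj : Function.Injective (G y) := Set.injOn_univ.mp (hG y).injOn
  rw [Nat.cast_le, ← Finset.card_image_of_injective L hGinj]
  refine card_le_of_mod_eq_of_log_eq _ ?_ ?_ ?_ <;> refine Finset.forall_mem_image.mpr ?_
  · exact fun x' _ => (hmem y x').1
  · exact fun x' hx' => (hL x' hx').1
  · exact fun x' hx' => (hL x' hx').2
end
end

section
/- Let 𝒵 = {0, 1, …, ⌊log|𝒳|⌋} (so |𝒵| = 1 + ⌊log|𝒳|⌋). For every guessing function G(·|Y) for X given Y, the deterministic task-encoder f(·|Y) defined by f(x|y) = ⌊log G(x|y)⌋ has decoding lists satisfying E[ |f^{-1}(f(X|Y) | Y)|^ρ ] ≤ E[G(X|Y)^ρ], where f^{-1}(z|y) = {x ∈ 𝒳 : P_{X|Y}(x|y) > 0 and f(x|y) = z}. -/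
open scoped BigOperators

noncomputable section

/-- A finite set on which an injective `g` has constant binary logarithm `k` has at most `2 ^ k`
elements, since `g` maps it into `[2 ^ k, 2 ^ (k + 1))`. -/
theorem card_le_two_pow_of_log_eq {α : Type*} {g : α → ℕ} {k : ℕ} {s : Finset α}
    (hinj : Set.InjOn g s) (hpos : ∀ x ∈ s, g x ≠ 0) (hlog : ∀ x ∈ s, Nat.log 2 (g x) = k) :
    s.card ≤ 2 ^ k := by
  have hmaps : Set.MapsTo g s (Finset.Ico (2 ^ k) (2 ^ (k + 1))) := by
    intro x hx
    rw [Finset.mem_coe, Finset.mem_Ico, ← hlog x hx]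
    exact ⟨Nat.pow_log_le_self 2 (hpos x hx), Nat.lt_pow_succ_log_self one_lt_two _⟩
  calc s.card ≤ (Finset.Ico (2 ^ k) (2 ^ (k + 1))).card :=
        Finset.card_le_card_of_injOn g hmaps hinj
    _ = 2 ^ k := by rw [Nat.card_Ico, pow_succ]; omega

/-- Corollary: the explicit deterministic task-encoder `f(x|y) = ⌊log₂ G(x|y)⌋`, with
description alphabet `{0, 1, …, ⌊log₂ |𝒳|⌋}`, has decoding lists whose ρ-th moment is at
most the ρ-th moment of the number of guesses of `G`. -/
theorem floor_log_guess_encoder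
    {𝒳 𝒴 : Type*} [Fintype 𝒳] [Fintype 𝒴]
    (ρ : ℝ) (hρ : 0 < ρ)
    (p : 𝒳 → 𝒴 → ℝ) (hp0 : ∀ x y, 0 ≤ p x y) (hp1 : ∑ x : 𝒳, ∑ y : 𝒴, p x y = 1)
    (G : 𝒴 → 𝒳 → ℕ) (hG : IsGuess G) :
    (∀ x y, Nat.log 2 (G y x) ≤ Nat.log 2 (Fintype.card 𝒳)) ∧
    (∑ x : 𝒳, ∑ y : 𝒴, p x y *
        (((Finset.univ.filter fun x' : 𝒳 =>
            0 < p x' y ∧ Nat.log 2 (G y x') = Nat.log 2 (G y x)).card : ℝ)) ^ ρ) ≤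
      ∑ x : 𝒳, ∑ y : 𝒴, p x y * (G y x : ℝ) ^ ρ := by
  have hmem : ∀ x y, G y x ∈ Set.Icc 1 (Fintype.card 𝒳) :=
    fun x y => (hG y).mapsTo (Set.mem_univ x)
  have hne : ∀ x y, G y x ≠ 0 := fun x y => Nat.one_le_iff_ne_zero.mp (hmem x y).1
  refine ⟨fun x y => Nat.log_mono_right (hmem x y).2,
    Finset.sum_le_sum fun x _ => Finset.sum_le_sum fun y _ => ?_⟩
  refine mul_le_mul_of_nonneg_left
    (Real.rpow_le_rpow (Nat.cast_nonneg _) (Nat.cast_le.mpr ?_) hρ.le) (hp0 x y)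
  refine (card_le_two_pow_of_log_eq (g := G y) ((hG y).injOn.mono (Set.subset_univ _))
    (fun x' _ => hne x' y) fun x' hx' => ?_).trans (Nat.pow_log_le_self 2 (hne x y))
  exact (Finset.mem_filter.mp hx').2.2
end
end

section
/- Let 𝒵 be a finite set and let P(Z = z | X = x, Y = y) be any stochastic task-encoder for X given Y with decoding lists {L^y_z}. Define a deterministic task-encoder f(·|Y) by choosing, for every (x,y) with P_{X|Y}(x|y) > 0, f(x|y) ∈ argmin_{z ∈ 𝒵 : x ∈ L^y_z} |L^y_z| (and arbitrarily otherwise). Then E[ |f^{-1}(f(X|Y) | Y)|^ρ ] ≤ E[|L^Y_Z|^ρ], i.e. the deterministic task-encoder performs at least as well as the stochastic one. -/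
open scoped BigOperators

noncomputable section

theorem deterministic_task_encoder_at_least_as_good
    {𝒳 𝒴 𝒵 : Type*} [Fintype 𝒳] [Fintype 𝒴] [Fintype 𝒵] [DecidableEq 𝒵]
    (ρ : ℝ) (hρ : 0 < ρ)
    (p : 𝒳 → 𝒴 → ℝ) (hp0 : ∀ x y, 0 ≤ p x y) (hp1 : ∑ x : 𝒳, ∑ y : 𝒴, p x y = 1)
    (w : 𝒳 → 𝒴 → 𝒵 → ℝ) (hw0 : ∀ x y z, 0 ≤ w x y z) (hw1 : ∀ x y, ∑ z : 𝒵, w x y z = 1)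
    (f : 𝒴 → 𝒳 → 𝒵)
    (hf : ∀ x y, 0 < p x y →
      (0 < p x y * w x y (f y x)) ∧
      ∀ z, 0 < p x y * w x y z →
        (Finset.univ.filter fun x' : 𝒳 => 0 < p x' y * w x' y (f y x)).card ≤
          (Finset.univ.filter fun x' : 𝒳 => 0 < p x' y * w x' y z).card) :
    (∑ x : 𝒳, ∑ y : 𝒴, p x y *
        (((Finset.univ.filter fun x' : 𝒳 => 0 < p x' y ∧ f y x' = f y x).card : ℝ)) ^ ρ) ≤
      ∑ x : 𝒳, ∑ y : 𝒴, ∑ z : 𝒵, p x y * w x y z *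
        (((Finset.univ.filter fun x' : 𝒳 => 0 < p x' y * w x' y z).card : ℝ)) ^ ρ := by
  refine Finset.sum_le_sum fun x _ => Finset.sum_le_sum fun y _ => ?_
  have hsum : ∑ z : 𝒵, p x y * w x y z = p x y := by
    rw [← Finset.mul_sum, hw1, mul_one]
  conv_lhs => rw [← hsum, Finset.sum_mul]
  refine Finset.sum_le_sum fun z _ => ?_
  rcases (mul_nonneg (hp0 x y) (hw0 x y z)).eq_or_lt with h | h
  · simp [← h]
  · have hx : 0 < p x y := pos_of_mul_pos_left h (hw0 x y z)
    have hcard : (Finset.univ.filter fun x' : 𝒳 => 0 < p x' y ∧ f y x' = f y x).card ≤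
        (Finset.univ.filter fun x' : 𝒳 => 0 < p x' y * w x' y z).card := by
      refine (Finset.card_le_card fun x' hx' => ?_).trans ((hf x y hx).2 z h)
      simp only [Finset.mem_filter, Finset.mem_univ, true_and] at hx' ⊢
      exact hx'.2 ▸ (hf x' y hx'.1).1
    gcongr
end
end

section
/- (Finite-blocklength list version, achievability.) Suppose |𝒨₁|·|𝒨₂| > log|𝒳| + 2. For every triple (c_s, c₁, c₂) of positive integers satisfying c_s ≤ min(|𝒨₁|, |𝒨₂|), c₁ ≤ ⌊|𝒨₁|/c_s⌋, c₂ ≤ ⌊|𝒨₂|/c_s⌋, and c_s c₁ c₂ > log|𝒳| + 2, there is a choice of Alice's encoder (a conditional PMF P(M₁ = m₁, M₂ = m₂ | X = x, Y = y)) for which Bob's list ambiguity satisfies 𝒜_B^l < 1 + 2^{ρ(H_{1/(1+ρ)}(X|Y) − log(c_s c₁ c₂ − log|𝒳| − 2) + 2)} and Eve's ambiguity satisfies 𝒜_E ≥ (1 + ln|𝒳|)^{−ρ} · 2^{ρ(H_{1/(1+ρ)}(X|Y) − log(c₁ + c₂))}. -/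
open scoped BigOperators

noncomputable section

/-- The conditional Rényi entropy `H_α(X|Y)` (base 2) of order `α = 1/(1+ρ)`. -/
def condRenyi {X Y : Type*} [Fintype X] [Fintype Y] (ρ : ℝ) (p : X → Y → ℝ) : ℝ :=
  ((1 / (1 + ρ)) / (1 - 1 / (1 + ρ))) *
    Real.logb 2 (∑ y : Y, (∑ x : X, p x y ^ (1 / (1 + ρ))) ^ (1 / (1 / (1 + ρ))))

/-- Bob's guessing ambiguity `𝒜_B^g`: the least ρ-th moment of the number of guesses that
Bob, observing `(Y, M₁, M₂)`, needs to guess `X`. -/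
def bobGuessAmb {𝒳 𝒴 M₁ M₂ : Type*} [Fintype 𝒳] [Fintype 𝒴] [Fintype M₁] [Fintype M₂]
    (ρ : ℝ) (p : 𝒳 → 𝒴 → ℝ) (e : 𝒳 → 𝒴 → M₁ × M₂ → ℝ) : ℝ :=
  sInf {r : ℝ | ∃ G : 𝒴 × M₁ × M₂ → 𝒳 → ℕ, IsGuess G ∧
    r = ∑ x : 𝒳, ∑ y : 𝒴, ∑ m : M₁ × M₂, p x y * e x y m * (G (y, m) x : ℝ) ^ ρ}

/-- Bob's list ambiguity `𝒜_B^l`: the ρ-th moment of the size of the list of realizations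
of `X` with positive posterior probability given `(Y, M₁, M₂)`. -/
def bobListAmb {𝒳 𝒴 M₁ M₂ : Type*} [Fintype 𝒳] [Fintype 𝒴] [Fintype M₁] [Fintype M₂]
    (ρ : ℝ) (p : 𝒳 → 𝒴 → ℝ) (e : 𝒳 → 𝒴 → M₁ × M₂ → ℝ) : ℝ :=
  ∑ x : 𝒳, ∑ y : 𝒴, ∑ m : M₁ × M₂, p x y * e x y m *
    (((Finset.univ.filter fun x' : 𝒳 => 0 < p x' y * e x' y m).card : ℝ)) ^ ρ

/-- Eve's ambiguity `𝒜_E`: the least ρ-th moment of the number of guesses, where for every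
realization the more informative of the two hints is used. -/
def eveAmb {𝒳 𝒴 M₁ M₂ : Type*} [Fintype 𝒳] [Fintype 𝒴] [Fintype M₁] [Fintype M₂]
    (ρ : ℝ) (p : 𝒳 → 𝒴 → ℝ) (e : 𝒳 → 𝒴 → M₁ × M₂ → ℝ) : ℝ :=
  sInf {r : ℝ | ∃ G₁ : 𝒴 × M₁ → 𝒳 → ℕ, ∃ G₂ : 𝒴 × M₂ → 𝒳 → ℕ, IsGuess G₁ ∧ IsGuess G₂ ∧
    r = ∑ x : 𝒳, ∑ y : 𝒴, ∑ m₁ : M₁, ∑ m₂ : M₂, p x y * e x y (m₁, m₂) *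
      ((min (G₁ (y, m₁) x) (G₂ (y, m₂) x) : ℕ) : ℝ) ^ ρ}

/-- The alternative (less conservative) Eve ambiguity `Ã_E`. -/
def eveAmbAlt {𝒳 𝒴 M₁ M₂ : Type*} [Fintype 𝒳] [Fintype 𝒴] [Fintype M₁] [Fintype M₂]
    (ρ : ℝ) (p : 𝒳 → 𝒴 → ℝ) (e : 𝒳 → 𝒴 → M₁ × M₂ → ℝ) : ℝ :=
  min
    (sInf {r : ℝ | ∃ G₁ : 𝒴 × M₁ → 𝒳 → ℕ, IsGuess G₁ ∧
      r = ∑ x : 𝒳, ∑ y : 𝒴, ∑ m₁ : M₁, ∑ m₂ : M₂, p x y * e x y (m₁, m₂) *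
        (G₁ (y, m₁) x : ℝ) ^ ρ})
    (sInf {r : ℝ | ∃ G₂ : 𝒴 × M₂ → 𝒳 → ℕ, IsGuess G₂ ∧
      r = ∑ x : 𝒳, ∑ y : 𝒴, ∑ m₁ : M₁, ∑ m₂ : M₂, p x y * e x y (m₁, m₂) *
        (G₂ (y, m₂) x : ℝ) ^ ρ})

theorem exists_map_card_fiber_le {α T : Type*} [Fintype α] [Fintype T] (A : Finset α)
    (lam : α → ℕ) (hlam : ∀ x ∈ A, 1 ≤ lam x)
    (hT : 2 * ∑ x ∈ A, (1 / lam x : ℝ) + Real.logb 2 (Fintype.card α) + 2 ≤ Fintype.card T) :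
    ∃ f : α → T, ∀ x ∈ A, ∀ B : Finset α, (∀ x' ∈ B, x' ∈ A ∧ f x' = f x) →
      B.card ≤ lam x := by
  classical
  rcases isEmpty_or_nonempty α with hα | hα
  · exact ⟨fun x => isEmptyElim x, fun x => isEmptyElim x⟩
  have hcard : Fintype.card α ≠ 0 := Fintype.card_ne_zero
  set L := Nat.log 2 (Fintype.card α) with hL
  let level : α → Fin (L + 1) := fun x => ⟨min (Nat.log 2 (lam x)) L, by omega⟩
  let C : Fin (L + 1) → Finset α := fun m => A.filter fun x => level x = m
  let K : Fin (L + 1) → ℕ := fun m => (C m).card / 2 ^ (m : ℕ) + 1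
  have hLlog : (L : ℝ) ≤ Real.logb 2 (Fintype.card α) := by
    rw [Real.le_logb_iff_rpow_le (by norm_num) (by positivity), Real.rpow_natCast]
    exact_mod_cast Nat.pow_log_le_self 2 hcard
  have hlast : (K (Fin.last L) : ℝ) ≤ 2 := by
    have h1 : (C (Fin.last L)).card < 2 ^ L * 2 := by
      rw [← pow_succ]
      exact (Finset.card_le_univ _).trans_lt (Nat.lt_pow_succ_log_self (by norm_num) _)
    have h2 : (C (Fin.last L)).card / 2 ^ L < 2 := Nat.div_lt_of_lt_mul h1
    have h3 : K (Fin.last L) ≤ 2 := by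
      simp only [K, Fin.val_last]
      omega
    exact_mod_cast h3
  have hinit : ∀ m : Fin L, (K m.castSucc : ℝ) ≤
      2 * ∑ x ∈ C m.castSucc, (1 / lam x : ℝ) + 1 := by
    intro m
    have h1 : (((C m.castSucc).card / 2 ^ (m : ℕ) : ℕ) : ℝ) ≤
        (C m.castSucc).card * (1 / 2 ^ (m : ℕ)) := by
      refine Nat.cast_div_le.trans_eq ?_
      push_cast
      ring
    have h2 : (C m.castSucc).card * (1 / 2 ^ (m : ℕ) : ℝ) ≤
        ∑ x ∈ C m.castSucc, 2 * (1 / lam x : ℝ) := by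
      rw [← nsmul_eq_mul]
      refine Finset.card_nsmul_le_sum _ _ _ fun x hx => ?_
      obtain ⟨hxA, hx⟩ := Finset.mem_filter.1 hx
      have hm : Nat.log 2 (lam x) = m := by
        have := congrArg Fin.val hx
        simp only [level, Fin.val_castSucc] at this
        have := m.2
        omega
      have hlt : lam x < 2 ^ (m : ℕ) * 2 := by
        rw [← hm, ← pow_succ]
        exact Nat.lt_pow_succ_log_self (by norm_num) _
      have hpos : (0 : ℝ) < lam x := by exact_mod_cast hlam x hxA
      have hle : (lam x : ℝ) ≤ 2 ^ (m : ℕ) * 2 := by exact_mod_cast hlt.le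
      rw [mul_one_div, div_le_div_iff₀ (by positivity) hpos]
      linarith
    rw [← Finset.mul_sum] at h2
    simp only [K, Fin.val_castSucc, Nat.cast_add, Nat.cast_one]
    linarith
  have hsum : ∑ m, ∑ x ∈ C m, (1 / lam x : ℝ) = ∑ x ∈ A, (1 / lam x : ℝ) :=
    Finset.sum_fiberwise A level _
  have hK : Fintype.card (Σ m, Fin (K m)) ≤ Fintype.card T := by
    rw [Fintype.card_sigma]
    simp only [Fintype.card_fin]
    have : (∑ m, K m : ℝ) ≤ Fintype.card T := by
      refine le_trans ?_ hT
      rw [← hsum, Fin.sum_univ_castSucc, Fin.sum_univ_castSucc]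
      have h1 := Finset.sum_le_sum fun m (_ : m ∈ Finset.univ) => hinit m
      have h2 : 0 ≤ ∑ x ∈ C (Fin.last L), (1 / lam x : ℝ) :=
        Finset.sum_nonneg fun _ _ => by positivity
      rw [Finset.sum_add_distrib, ← Finset.mul_sum] at h1
      simp only [Finset.sum_const, Finset.card_univ, Fintype.card_fin, nsmul_eq_mul,
        mul_one] at h1
      linarith
    exact_mod_cast this
  obtain ⟨emb⟩ := Function.Embedding.nonempty_of_card_le hK
  let idx : (m : Fin (L + 1)) → α → ℕ := fun m x =>
    if h : x ∈ C m then ((C m).equivFin ⟨x, h⟩ : ℕ) else 0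
  have hidx : ∀ m x, idx m x / 2 ^ (m : ℕ) < K m := by
    intro m x
    refine Nat.lt_succ_of_le (Nat.div_le_div_right ?_)
    simp only [idx]
    split_ifs with h
    · exact ((C m).equivFin ⟨x, h⟩).2.le
    · exact Nat.zero_le _
  refine ⟨fun x => emb ⟨level x, ⟨idx (level x) x / 2 ^ (level x : ℕ), hidx _ _⟩⟩,
    fun x hx B hB => ?_⟩
  have hpow : 2 ^ (level x : ℕ) ≤ lam x := by
    refine le_trans (Nat.pow_le_pow_right (by norm_num) (min_le_left _ _))
      (Nat.pow_log_le_self 2 ?_)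
    have := hlam x hx
    omega
  refine le_trans ?_ hpow
  have hB' : ∀ x' ∈ B, x' ∈ C (level x) ∧
      idx (level x) x' / 2 ^ (level x : ℕ) = idx (level x) x / 2 ^ (level x : ℕ) := by
    intro x' hx'
    obtain ⟨hA, hf⟩ := hB x' hx'
    have h := emb.injective hf
    have hl : level x' = level x := congrArg Sigma.fst h
    refine ⟨Finset.mem_filter.2 ⟨hA, hl⟩, ?_⟩
    have h2 := congrArg (fun s : (Σ m, Fin (K m)) => (s.2 : ℕ)) h
    simp only [hl] at h2
    exact h2
  set m := level x
  set j := idx m x / 2 ^ (m : ℕ)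
  have hmaps : ∀ x' ∈ B, idx m x' ∈ Finset.Ico (j * 2 ^ (m : ℕ)) ((j + 1) * 2 ^ (m : ℕ)) := by
    intro x' hx'
    obtain ⟨-, h⟩ := hB' x' hx'
    rw [Finset.mem_Ico, ← h]
    exact ⟨Nat.div_mul_le_self _ _, (Nat.div_lt_iff_lt_mul (by positivity)).1 (Nat.lt_succ_self _)⟩
  have hinj : Set.InjOn (idx m) B := by
    intro a ha b hb hab
    have ha' := (hB' a ha).1
    have hb' := (hB' b hb).1
    simp only [idx, dif_pos ha', dif_pos hb'] at hab
    simpa using (C m).equivFin.injective (Fin.ext hab)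
  refine (Finset.card_le_card_of_injOn _ hmaps hinj).trans_eq ?_
  rw [Nat.card_Ico, add_mul, one_mul, Nat.add_sub_cancel_left]

theorem natCeil_rpow_lt {ρ ξ : ℝ} (hρ : 0 < ρ) (hξ : 0 < ξ) :
    (⌈ξ⌉₊ : ℝ) ^ ρ < 1 + (2 * ξ) ^ ρ := by
  rcases le_or_gt ξ 1 with h | h
  · have h1 : (⌈ξ⌉₊ : ℝ) ≤ 1 := by exact_mod_cast Nat.ceil_le.2 (by simpa using h)
    have := Real.rpow_le_one (Nat.cast_nonneg _) h1 hρ.le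
    have : 0 < (2 * ξ) ^ ρ := by positivity
    linarith
  · have h1 : (⌈ξ⌉₊ : ℝ) ≤ 2 * ξ := by
      have := Nat.ceil_lt_add_one hξ.le
      linarith
    have := Real.rpow_le_rpow (Nat.cast_nonneg _) h1 hρ.le
    linarith

theorem exists_map_moment_card_fiber_lt {α T : Type*} [Fintype α] [Fintype T]
    {ρ : ℝ} (hρ : 0 < ρ) (q : α → ℝ) (hq : ∀ x, 0 ≤ q x)
    (hT : Real.logb 2 (Fintype.card α) + 2 < Fintype.card T) :
    ∃ f : α → T, ∀ x, 0 < q x → ∀ B : Finset α, (∀ x' ∈ B, 0 < q x' ∧ f x' = f x) →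
      q x * (B.card : ℝ) ^ ρ < q x +
        (4 * (∑ x', q x' ^ (1 / (1 + ρ))) /
          (Fintype.card T - Real.logb 2 (Fintype.card α) - 2)) ^ ρ * q x ^ (1 / (1 + ρ)) := by
  classical
  set S := ∑ x', q x' ^ (1 / (1 + ρ)) with hS
  set D : ℝ := Fintype.card T - Real.logb 2 (Fintype.card α) - 2 with hD
  have hD0 : 0 < D := by linarith
  let ξ : α → ℝ := fun x => 2 * S / D * (q x ^ (1 / (1 + ρ)))⁻¹
  have hSpos : ∀ x, 0 < q x → 0 < S := fun x hx =>
    Finset.sum_pos' (fun i _ => Real.rpow_nonneg (hq i) _)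
      ⟨x, Finset.mem_univ _, Real.rpow_pos_of_pos hx _⟩
  have hξ : ∀ x, 0 < q x → 0 < ξ x := fun x hx => by
    have := hSpos x hx
    positivity
  have hmu : 2 * ∑ x ∈ Finset.univ.filter (fun x => 0 < q x), (1 / (⌈ξ x⌉₊ : ℝ)) ≤ D := by
    rcases Finset.eq_empty_or_nonempty (Finset.univ.filter (fun x => 0 < q x)) with h | ⟨x₀, h₀⟩
    · rw [h]
      simpa using hD0.le
    have hS0 : 0 < S := hSpos x₀ (Finset.mem_filter.1 h₀).2
    have h1 : ∑ x ∈ Finset.univ.filter (fun x => 0 < q x), (1 / (⌈ξ x⌉₊ : ℝ)) ≤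
        ∑ x, D / (2 * S) * q x ^ (1 / (1 + ρ)) := by
      refine (Finset.sum_le_sum fun x hx => ?_).trans
        (Finset.sum_le_sum_of_subset_of_nonneg (Finset.filter_subset _ _) fun x _ _ => ?_)
      · have hx := (Finset.mem_filter.1 hx).2
        refine (one_div_le_one_div_of_le (hξ x hx) (Nat.le_ceil _)).trans_eq ?_
        simp only [ξ]
        field_simp
      · have := Real.rpow_nonneg (hq x) (1 / (1 + ρ))
        positivity
    rw [← Finset.mul_sum, ← hS] at h1
    have h2 : D / (2 * S) * S = D / 2 := by field_simp
    linarith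
  obtain ⟨f, hf⟩ := exists_map_card_fiber_le (T := T) (Finset.univ.filter (fun x => 0 < q x))
    (fun x => ⌈ξ x⌉₊) (fun x hx => Nat.ceil_pos.2 (hξ x (Finset.mem_filter.1 hx).2))
    (by linarith)
  refine ⟨f, fun x hx B hB => ?_⟩
  have h1 : (B.card : ℝ) ≤ ⌈ξ x⌉₊ := by
    exact_mod_cast hf x (by simpa using hx) B (fun x' hx' => by simpa using hB x' hx')
  have h2 : (B.card : ℝ) ^ ρ < 1 + (2 * ξ x) ^ ρ :=
    (Real.rpow_le_rpow (Nat.cast_nonneg _) h1 hρ.le).trans_lt (natCeil_rpow_lt hρ (hξ x hx))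
  refine (mul_lt_mul_of_pos_left h2 hx).trans_eq ?_
  have hS0 := hSpos x hx
  have h3 : 2 * ξ x = 4 * S / D * (q x) ^ (-(1 / (1 + ρ))) := by
    rw [Real.rpow_neg hx.le]
    simp only [ξ]
    ring
  have h4 : q x * ((q x) ^ (-(1 / (1 + ρ)))) ^ ρ = q x ^ (1 / (1 + ρ)) := by
    rw [← Real.rpow_mul hx.le]
    nth_rewrite 1 [← Real.rpow_one (q x)]
    rw [← Real.rpow_add hx]
    congr 1
    field_simp
    ring
  rw [h3, Real.mul_rpow (by positivity) (by positivity), mul_add, mul_one, ← h4]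
  ring

theorem sum_rpow_le_moment_mul {ι : Type*} [Fintype ι] {ρ : ℝ} (hρ : 0 < ρ)
    (q g : ι → ℝ) (hq : ∀ i, 0 ≤ q i) (hg : ∀ i, 0 < g i) :
    (∑ i, q i ^ (1 / (1 + ρ))) ^ (1 + ρ) ≤ (∑ i, q i * g i ^ ρ) * (∑ i, (g i)⁻¹) ^ ρ := by
  have hpq : (1 + ρ).HolderConjugate ((1 + ρ) / ρ) := by
    rw [Real.holderConjugate_iff]
    constructor
    · linarith
    · field_simp
  have h := Real.inner_le_Lp_mul_Lq_of_nonneg (Finset.univ : Finset ι) hpq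
    (f := fun i => (q i * g i ^ ρ) ^ (1 / (1 + ρ)))
    (g := fun i => ((g i)⁻¹) ^ (ρ / (1 + ρ)))
    (fun i _ => by have := hq i; have := hg i; positivity)
    (fun i _ => by have := hg i; positivity)
  have e1 : ∀ i, (q i * g i ^ ρ) ^ (1 / (1 + ρ)) * ((g i)⁻¹) ^ (ρ / (1 + ρ)) =
      q i ^ (1 / (1 + ρ)) := by
    intro i
    have := hg i
    rw [Real.mul_rpow (hq i) (by positivity), ← Real.rpow_mul this.le, mul_one_div,
      Real.inv_rpow this.le, mul_assoc, mul_inv_cancel₀ (by positivity), mul_one]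
  have e2 : ∀ i, ((q i * g i ^ ρ) ^ (1 / (1 + ρ))) ^ (1 + ρ) = q i * g i ^ ρ := by
    intro i
    have := hg i
    have := hq i
    rw [← Real.rpow_mul (by positivity), one_div_mul_cancel (by positivity), Real.rpow_one]
  have e3 : ∀ i, (((g i)⁻¹) ^ (ρ / (1 + ρ))) ^ ((1 + ρ) / ρ) = (g i)⁻¹ := by
    intro i
    have := hg i
    rw [← Real.rpow_mul (by positivity), div_mul_div_cancel₀ (by positivity),
      div_self hρ.ne', Real.rpow_one]
  simp only [e1, e2, e3] at h
  have hA : 0 ≤ ∑ i, q i * g i ^ ρ :=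
    Finset.sum_nonneg fun i _ => by have := hq i; have := hg i; positivity
  have hB : 0 ≤ ∑ i, (g i)⁻¹ := Finset.sum_nonneg fun i _ => by have := hg i; positivity
  refine (Real.rpow_le_rpow (Finset.sum_nonneg fun i _ => Real.rpow_nonneg (hq i) _) h
    (by positivity)).trans_eq ?_
  rw [Real.mul_rpow (by positivity) (by positivity), ← Real.rpow_mul hA, ← Real.rpow_mul hB,
    one_div_mul_cancel (by positivity), Real.rpow_one]
  congr 2
  field_simp

theorem IsGuess.sum_inv_le {X V : Type*} [Fintype X] {G : V → X → ℕ} (hG : IsGuess G) (v : V) :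
    ∑ x, (G v x : ℝ)⁻¹ ≤ 1 + Real.log (Fintype.card X) := by
  refine le_trans (le_of_eq ?_) (harmonic_le_one_add_log (Fintype.card X))
  rw [harmonic_eq_sum_Icc]
  push_cast
  refine Finset.sum_nbij (G v) (fun x _ => ?_) (fun x _ y _ h => ?_) (fun k hk => ?_)
    (fun _ _ => rfl)
  · simpa using (hG v).mapsTo (Set.mem_univ x)
  · exact (hG v).injOn (Set.mem_univ x) (Set.mem_univ y) h
  · simpa using (hG v).surjOn (by simpa using hk)

theorem IsGuess.sum_sum_inv_le {X V : Type*} [Fintype X] [Fintype V] {G : V → X → ℕ}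
    (hG : IsGuess G) :
    ∑ x, ∑ v, (G v x : ℝ)⁻¹ ≤ Fintype.card V * (1 + Real.log (Fintype.card X)) := by
  rw [Finset.sum_comm]
  refine (Finset.sum_le_sum fun v _ => hG.sum_inv_le v).trans_eq ?_
  rw [Finset.sum_const, Finset.card_univ, nsmul_eq_mul]

theorem IsGuess.pos {X V : Type*} [Fintype X] {G : V → X → ℕ} (hG : IsGuess G) (v : V) (x : X) :
    0 < G v x :=
  ((hG v).mapsTo (Set.mem_univ x)).1

theorem two_rpow_condRenyi {X Y : Type*} [Fintype X] [Fintype Y] {ρ : ℝ} (hρ : 0 < ρ)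
    (p : X → Y → ℝ) (hp : 0 < ∑ y, (∑ x, p x y ^ (1 / (1 + ρ))) ^ (1 + ρ)) :
    (2 : ℝ) ^ (ρ * condRenyi ρ p) = ∑ y, (∑ x, p x y ^ (1 / (1 + ρ))) ^ (1 + ρ) := by
  have h : ρ * ((1 / (1 + ρ)) / (1 - 1 / (1 + ρ))) = 1 := by
    have : 1 - 1 / (1 + ρ) = ρ / (1 + ρ) := by field_simp; ring
    rw [this]
    field_simp
  rw [condRenyi, ← mul_assoc, h, one_mul, one_div_one_div,
    Real.rpow_logb (by norm_num) (by norm_num) hp]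

/-- The encoder that describes `(s, a, b) = f x y` by the hints `(s + u, a)` and `(u, b)`, where
the one-time pad `u` is uniformly distributed over `U`. -/
def padEncoder {𝒳 𝒴 M₁ M₂ U A B : Type*} [Fintype U] [Add U]
    (ι₁ : U × A → M₁) (ι₂ : U × B → M₂) (f : 𝒳 → 𝒴 → U × A × B) (x : 𝒳) (y : 𝒴)
    (m : M₁ × M₂) : ℝ :=
  open Classical in
  ∑ u : U, if m = (ι₁ ((f x y).1 + u, (f x y).2.1), ι₂ (u, (f x y).2.2))
    then (Fintype.card U : ℝ)⁻¹ else 0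

theorem padEncoder_nonneg {𝒳 𝒴 M₁ M₂ U A B : Type*} [Fintype U] [Add U]
    (ι₁ : U × A → M₁) (ι₂ : U × B → M₂) (f : 𝒳 → 𝒴 → U × A × B) (x : 𝒳) (y : 𝒴)
    (m : M₁ × M₂) : 0 ≤ padEncoder ι₁ ι₂ f x y m :=
  Finset.sum_nonneg fun _ _ => by split_ifs <;> positivity

theorem exists_pad_of_padEncoder_pos {𝒳 𝒴 M₁ M₂ U A B : Type*} [Fintype U] [Add U]
    {ι₁ : U × A → M₁} {ι₂ : U × B → M₂} {f : 𝒳 → 𝒴 → U × A × B} {x : 𝒳} {y : 𝒴}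
    {m : M₁ × M₂} (h : 0 < padEncoder ι₁ ι₂ f x y m) :
    ∃ u, m = (ι₁ ((f x y).1 + u, (f x y).2.1), ι₂ (u, (f x y).2.2)) := by
  by_contra! hne
  simp [padEncoder, hne] at h

theorem sum_padEncoder_mul {𝒳 𝒴 M₁ M₂ U A B : Type*} [Fintype M₁] [Fintype M₂] [Fintype U]
    [Add U] (ι₁ : U × A → M₁) (ι₂ : U × B → M₂) (f : 𝒳 → 𝒴 → U × A × B) (x : 𝒳) (y : 𝒴)
    (F : M₁ × M₂ → ℝ) :
    ∑ m, padEncoder ι₁ ι₂ f x y m * F m = ∑ u, (Fintype.card U : ℝ)⁻¹ *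
      F (ι₁ ((f x y).1 + u, (f x y).2.1), ι₂ (u, (f x y).2.2)) := by
  classical
  simp only [padEncoder, Finset.sum_mul, ite_mul, zero_mul]
  rw [Finset.sum_comm]
  simp

theorem sum_padEncoder {𝒳 𝒴 M₁ M₂ U A B : Type*} [Fintype M₁] [Fintype M₂] [Fintype U]
    [Nonempty U] [Add U] (ι₁ : U × A → M₁) (ι₂ : U × B → M₂) (f : 𝒳 → 𝒴 → U × A × B)
    (x : 𝒳) (y : 𝒴) : ∑ m, padEncoder ι₁ ι₂ f x y m = 1 := by
  have h := sum_padEncoder_mul ι₁ ι₂ f x y fun _ => 1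
  simpa using h

theorem bobListAmb_padEncoder_lt {𝒳 𝒴 M₁ M₂ U A B : Type*} [Fintype 𝒳] [Fintype 𝒴]
    [Fintype M₁] [Fintype M₂] [Fintype U] [Nonempty U] [AddGroup U] {ρ : ℝ}
    (p : 𝒳 → 𝒴 → ℝ) (hp0 : ∀ x y, 0 ≤ p x y) (hp1 : ∑ x, ∑ y, p x y = 1)
    {ι₁ : U × A → M₁} {ι₂ : U × B → M₂} (hι₁ : ι₁.Injective) (hι₂ : ι₂.Injective)
    (f : 𝒳 → 𝒴 → U × A × B) (w : 𝒳 → 𝒴 → ℝ) (hw : ∀ x y, 0 ≤ w x y)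
    (hf : ∀ x y, 0 < p x y → ∀ L : Finset 𝒳, (∀ x' ∈ L, 0 < p x' y ∧ f x' y = f x y) →
      p x y * (L.card : ℝ) ^ ρ < p x y + w x y) :
    bobListAmb ρ p (padEncoder ι₁ ι₂ f) < 1 + ∑ y, ∑ x, w x y := by
  have hmem : ∀ x y u x', 0 < p x' y * padEncoder ι₁ ι₂ f x' y
      (ι₁ ((f x y).1 + u, (f x y).2.1), ι₂ (u, (f x y).2.2)) →
      0 < p x' y ∧ f x' y = f x y := by
    intro x y u x' h
    have hpos : 0 < p x' y := pos_of_mul_pos_left h (padEncoder_nonneg _ _ _ _ _ _)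
    obtain ⟨u', hu⟩ := exists_pad_of_padEncoder_pos (pos_of_mul_pos_right h (hp0 x' y))
    simp only [Prod.mk.injEq, hι₁.eq_iff, hι₂.eq_iff] at hu
    obtain ⟨⟨h1, h2⟩, rfl, h3⟩ := hu
    exact ⟨hpos, Prod.ext (add_right_cancel h1).symm (Prod.ext h2.symm h3.symm)⟩
  have hcell : ∀ x y, ∑ m, p x y * padEncoder ι₁ ι₂ f x y m *
      (((Finset.univ.filter fun x' => 0 < p x' y * padEncoder ι₁ ι₂ f x' y m).card : ℝ)) ^ ρ =
      ∑ u : U, (Fintype.card U : ℝ)⁻¹ * (p x y * (((Finset.univ.filter fun x' =>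
        0 < p x' y * padEncoder ι₁ ι₂ f x' y
          (ι₁ ((f x y).1 + u, (f x y).2.1), ι₂ (u, (f x y).2.2))).card : ℝ)) ^ ρ) := by
    intro x y
    rw [← sum_padEncoder_mul ι₁ ι₂ f x y fun m => p x y *
      (((Finset.univ.filter fun x' => 0 < p x' y * padEncoder ι₁ ι₂ f x' y m).card : ℝ)) ^ ρ]
    exact Finset.sum_congr rfl fun m _ => by ring
  have hconst : ∀ c : ℝ, ∑ _u : U, (Fintype.card U : ℝ)⁻¹ * c = c := by
    intro c
    rw [Finset.sum_const, Finset.card_univ, nsmul_eq_mul, ← mul_assoc,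
      mul_inv_cancel₀ (by positivity), one_mul]
  have hlt : ∀ x y, 0 < p x y → ∑ m, p x y * padEncoder ι₁ ι₂ f x y m *
      (((Finset.univ.filter fun x' => 0 < p x' y * padEncoder ι₁ ι₂ f x' y m).card : ℝ)) ^ ρ <
      p x y + w x y := by
    intro x y hxy
    rw [hcell, ← hconst (p x y + w x y)]
    refine Finset.sum_lt_sum_of_nonempty Finset.univ_nonempty fun u _ => ?_
    refine mul_lt_mul_of_pos_left (hf x y hxy _ fun x' hx' => ?_) (by positivity)
    exact hmem x y u x' (Finset.mem_filter.1 hx').2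
  have hle : ∀ x y, ∑ m, p x y * padEncoder ι₁ ι₂ f x y m *
      (((Finset.univ.filter fun x' => 0 < p x' y * padEncoder ι₁ ι₂ f x' y m).card : ℝ)) ^ ρ ≤
      p x y + w x y := by
    intro x y
    rcases (hp0 x y).eq_or_lt with h | h
    · simpa [← h] using hw x y
    · exact (hlt x y h).le
  obtain ⟨x₀, y₀, h₀⟩ : ∃ x y, 0 < p x y := by
    by_contra! h
    have : ∀ x y, p x y = 0 := fun x y => le_antisymm (h x y) (hp0 x y)
    simp [this] at hp1
  rw [Finset.sum_comm (f := fun y x => w x y), ← hp1, ← Finset.sum_add_distrib]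
  simp only [← Finset.sum_add_distrib]
  exact Finset.sum_lt_sum (fun x _ => Finset.sum_le_sum fun y _ => hle x y)
    ⟨x₀, Finset.mem_univ _, Finset.sum_lt_sum (fun y _ => hle x₀ y)
      ⟨y₀, Finset.mem_univ _, hlt x₀ y₀ h₀⟩⟩

theorem sum_inv_min_guess_le {𝒳 U A B : Type*} [Fintype 𝒳] [Fintype U] [Fintype A] [Fintype B]
    [AddGroup U] {G₁ : U × A → 𝒳 → ℕ} {G₂ : U × B → 𝒳 → ℕ}
    (hG₁ : IsGuess G₁) (hG₂ : IsGuess G₂) (f : 𝒳 → U × A × B) :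
    ∑ i : 𝒳 × U, ((min (G₁ ((f i.1).1 + i.2, (f i.1).2.1) i.1)
      (G₂ (i.2, (f i.1).2.2) i.1) : ℕ) : ℝ)⁻¹ ≤
      Fintype.card U * ((Fintype.card A + Fintype.card B) *
        (1 + Real.log (Fintype.card 𝒳))) := by
  have hmin : ∀ a b : ℕ, ((min a b : ℕ) : ℝ)⁻¹ ≤ (a : ℝ)⁻¹ + (b : ℝ)⁻¹ := by
    intro a b
    rcases min_choice a b with h | h <;> rw [h]
    · exact le_add_of_nonneg_right (by positivity)
    · exact le_add_of_nonneg_left (by positivity)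
  have h₁ : ∑ x, ∑ u, (G₁ ((f x).1 + u, (f x).2.1) x : ℝ)⁻¹ ≤ ∑ x, ∑ v, (G₁ v x : ℝ)⁻¹ := by
    refine Finset.sum_le_sum fun x _ => ?_
    refine (Equiv.sum_comp (Equiv.addLeft (f x).1)
      fun u => (G₁ (u, (f x).2.1) x : ℝ)⁻¹).trans_le ?_
    rw [Fintype.sum_prod_type]
    exact Finset.sum_le_sum fun u _ => Finset.single_le_sum
      (f := fun a => (G₁ (u, a) x : ℝ)⁻¹) (fun _ _ => by positivity) (Finset.mem_univ _)
  have h₂ : ∑ x, ∑ u, (G₂ (u, (f x).2.2) x : ℝ)⁻¹ ≤ ∑ x, ∑ v, (G₂ v x : ℝ)⁻¹ := by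
    refine Finset.sum_le_sum fun x _ => ?_
    rw [Fintype.sum_prod_type]
    exact Finset.sum_le_sum fun u _ => Finset.single_le_sum
      (f := fun a => (G₂ (u, a) x : ℝ)⁻¹) (fun _ _ => by positivity) (Finset.mem_univ _)
  have t₁ := hG₁.sum_sum_inv_le
  have t₂ := hG₂.sum_sum_inv_le
  simp only [Fintype.card_prod, Nat.cast_mul] at t₁ t₂
  refine (Finset.sum_le_sum fun i _ => hmin _ _).trans ?_
  rw [Fintype.sum_prod_type]
  simp only [Finset.sum_add_distrib]
  linarith

theorem sum_rpow_le_min_guess_moment_mul {𝒳 U A B : Type*} [Fintype 𝒳] [Fintype U] [Fintype A]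
    [Fintype B] [Nonempty U] [AddGroup U] {ρ : ℝ} (hρ : 0 < ρ) (q : 𝒳 → ℝ) (hq : ∀ x, 0 ≤ q x)
    {G₁ : U × A → 𝒳 → ℕ} {G₂ : U × B → 𝒳 → ℕ} (hG₁ : IsGuess G₁) (hG₂ : IsGuess G₂)
    (f : 𝒳 → U × A × B) :
    (∑ x, q x ^ (1 / (1 + ρ))) ^ (1 + ρ) ≤
      (∑ x, ∑ u, (Fintype.card U : ℝ)⁻¹ * (q x *
        ((min (G₁ ((f x).1 + u, (f x).2.1) x) (G₂ (u, (f x).2.2) x) : ℕ) : ℝ) ^ ρ)) *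
      ((Fintype.card A + Fintype.card B) * (1 + Real.log (Fintype.card 𝒳))) ^ ρ := by
  have hU : (0 : ℝ) < Fintype.card U := by positivity
  set g : 𝒳 × U → ℝ := fun i => ((min (G₁ ((f i.1).1 + i.2, (f i.1).2.1) i.1)
      (G₂ (i.2, (f i.1).2.2) i.1) : ℕ) : ℝ) with hg
  have hg0 : ∀ i, 0 < g i := fun i => by
    have : 0 < min (G₁ ((f i.1).1 + i.2, (f i.1).2.1) i.1) (G₂ (i.2, (f i.1).2.2) i.1) :=
      lt_min (hG₁.pos _ _) (hG₂.pos _ _)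
    exact Nat.cast_pos.2 this
  have h := sum_rpow_le_moment_mul hρ (fun i : 𝒳 × U => q i.1) g (fun i => hq i.1) hg0
  have hS : 0 ≤ ∑ x, q x ^ (1 / (1 + ρ)) :=
    Finset.sum_nonneg fun x _ => Real.rpow_nonneg (hq x) _
  have hlog : 0 ≤ Real.log (Fintype.card 𝒳) := Real.log_natCast_nonneg _
  have hE : 0 ≤ ∑ i : 𝒳 × U, q i.1 * g i ^ ρ :=
    Finset.sum_nonneg fun i _ => mul_nonneg (hq _) (Real.rpow_nonneg (hg0 i).le _)
  have h2 := Real.rpow_le_rpow (Finset.sum_nonneg fun i _ => (inv_pos.2 (hg0 i)).le)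
    (sum_inv_min_guess_le hG₁ hG₂ f) hρ.le
  have h3 := h.trans (mul_le_mul_of_nonneg_left h2 hE)
  have hL : ∑ i : 𝒳 × U, q i.1 ^ (1 / (1 + ρ)) =
      Fintype.card U * ∑ x, q x ^ (1 / (1 + ρ)) := by
    rw [Fintype.sum_prod_type, Finset.mul_sum]
    simp [Finset.card_univ]
  rw [hL, Real.mul_rpow hU.le hS, Real.mul_rpow hU.le (by positivity), Real.rpow_add hU,
    Real.rpow_one, Fintype.sum_prod_type] at h3
  have hUρ : (0 : ℝ) < (Fintype.card U : ℝ) * (Fintype.card U : ℝ) ^ ρ := by positivity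
  simp only [← Finset.mul_sum]
  simp only [← Finset.mul_sum] at h3
  refine le_of_mul_le_mul_left (h3.trans_eq ?_) hUρ
  have hcancel : (Fintype.card U : ℝ) * (Fintype.card U : ℝ)⁻¹ = 1 := mul_inv_cancel₀ hU.ne'
  linear_combination (-(∑ x, q x * ∑ u, g (x, u) ^ ρ) * (Fintype.card U : ℝ) ^ ρ *
    ((Fintype.card A + Fintype.card B) * (1 + Real.log (Fintype.card 𝒳))) ^ ρ) * hcancel

theorem le_eveAmb_padEncoder {𝒳 𝒴 M₁ M₂ U A B : Type*} [Fintype 𝒳] [Fintype 𝒴]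
    [Fintype M₁] [Fintype M₂] [Fintype U] [Fintype A] [Fintype B] [Nonempty U] [Nonempty A]
    [AddGroup U] {ρ : ℝ} (hρ : 0 < ρ) (p : 𝒳 → 𝒴 → ℝ) (hp0 : ∀ x y, 0 ≤ p x y)
    (ι₁ : U × A → M₁) (ι₂ : U × B → M₂) (f : 𝒳 → 𝒴 → U × A × B) :
    ((Fintype.card A + Fintype.card B) * (1 + Real.log (Fintype.card 𝒳))) ^ (-ρ) *
      ∑ y, (∑ x, p x y ^ (1 / (1 + ρ))) ^ (1 + ρ) ≤ eveAmb ρ p (padEncoder ι₁ ι₂ f) := by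
  have hlog : 0 ≤ Real.log (Fintype.card 𝒳) := Real.log_natCast_nonneg _
  have hA : (0 : ℝ) < Fintype.card A := by positivity
  have hC : (0 : ℝ) < (Fintype.card A + Fintype.card B) * (1 + Real.log (Fintype.card 𝒳)) := by
    positivity
  obtain ⟨G₁, hG₁⟩ := exists_isGuess 𝒳 (𝒴 × M₁)
  obtain ⟨G₂, hG₂⟩ := exists_isGuess 𝒳 (𝒴 × M₂)
  refine le_csInf ⟨_, G₁, G₂, hG₁, hG₂, rfl⟩ ?_
  rintro r ⟨G₁, G₂, hG₁, hG₂, rfl⟩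
  have hcell : ∀ x y, ∑ m₁, ∑ m₂, p x y * padEncoder ι₁ ι₂ f x y (m₁, m₂) *
      ((min (G₁ (y, m₁) x) (G₂ (y, m₂) x) : ℕ) : ℝ) ^ ρ =
      ∑ u : U, (Fintype.card U : ℝ)⁻¹ * (p x y *
        ((min (G₁ (y, ι₁ ((f x y).1 + u, (f x y).2.1)) x)
          (G₂ (y, ι₂ (u, (f x y).2.2)) x) : ℕ) : ℝ) ^ ρ) := by
    intro x y
    rw [← sum_padEncoder_mul ι₁ ι₂ f x y fun m => p x y *
      ((min (G₁ (y, m.1) x) (G₂ (y, m.2) x) : ℕ) : ℝ) ^ ρ, Fintype.sum_prod_type]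
    exact Finset.sum_congr rfl fun m₁ _ => Finset.sum_congr rfl fun m₂ _ => by ring
  simp only [hcell]
  rw [Finset.sum_comm, Finset.mul_sum]
  refine Finset.sum_le_sum fun y _ => ?_
  rw [Real.rpow_neg hC.le, inv_mul_le_iff₀ (by positivity), mul_comm]
  exact sum_rpow_le_min_guess_moment_mul hρ (fun x => p x y) (fun x => hp0 x y)
    (G₁ := fun v => G₁ (y, ι₁ v)) (G₂ := fun v => G₂ (y, ι₂ v))
    (fun v => hG₁ _) (fun v => hG₂ _) (fun x => f x y)

/-- Theorem 6 (finite-blocklength list version), achievability part. -/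
theorem distributed_storage_list_achievability
    {𝒳 𝒴 M₁ M₂ : Type*} [Fintype 𝒳] [Fintype 𝒴] [Fintype M₁] [Fintype M₂]
    (ρ : ℝ) (hρ : 0 < ρ)
    (p : 𝒳 → 𝒴 → ℝ) (hp0 : ∀ x y, 0 ≤ p x y) (hp1 : ∑ x : 𝒳, ∑ y : 𝒴, p x y = 1)
    (hM : Real.logb 2 (Fintype.card 𝒳) + 2 <
      ((Fintype.card M₁ * Fintype.card M₂ : ℕ) : ℝ))
    (cs c₁ c₂ : ℕ) (hcs : 0 < cs) (hc₁ : 0 < c₁) (hc₂ : 0 < c₂)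
    (hcs' : cs ≤ min (Fintype.card M₁) (Fintype.card M₂))
    (hc₁' : c₁ ≤ Fintype.card M₁ / cs) (hc₂' : c₂ ≤ Fintype.card M₂ / cs)
    (hccc : Real.logb 2 (Fintype.card 𝒳) + 2 < ((cs * c₁ * c₂ : ℕ) : ℝ)) :
    ∃ e : 𝒳 → 𝒴 → M₁ × M₂ → ℝ,
      (∀ x y m, 0 ≤ e x y m) ∧ (∀ x y, ∑ m : M₁ × M₂, e x y m = 1) ∧
      bobListAmb ρ p e <
        1 + (2 : ℝ) ^ (ρ * (condRenyi ρ p -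
          Real.logb 2 (((cs * c₁ * c₂ : ℕ) : ℝ) - Real.logb 2 (Fintype.card 𝒳) - 2) + 2)) ∧
      (1 + Real.log (Fintype.card 𝒳)) ^ (-ρ) *
          (2 : ℝ) ^ (ρ * (condRenyi ρ p - Real.logb 2 ((c₁ + c₂ : ℕ) : ℝ))) ≤
        eveAmb ρ p e := by
  classical
  have : NeZero cs := ⟨hcs.ne'⟩
  have : Nonempty (Fin c₁) := ⟨⟨0, hc₁⟩⟩
  obtain ⟨ι₁⟩ : Nonempty (ZMod cs × Fin c₁ ↪ M₁) := by
    refine Function.Embedding.nonempty_of_card_le ?_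
    rw [Fintype.card_prod, ZMod.card, Fintype.card_fin]
    exact (Nat.mul_le_mul_left _ hc₁').trans (Nat.mul_div_le _ _)
  obtain ⟨ι₂⟩ : Nonempty (ZMod cs × Fin c₂ ↪ M₂) := by
    refine Function.Embedding.nonempty_of_card_le ?_
    rw [Fintype.card_prod, ZMod.card, Fintype.card_fin]
    exact (Nat.mul_le_mul_left _ hc₂').trans (Nat.mul_div_le _ _)
  have hT : Fintype.card (ZMod cs × Fin c₁ × Fin c₂) = cs * c₁ * c₂ := by
    simp [Fintype.card_prod, ZMod.card, mul_assoc]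
  have hex := fun y => exists_map_moment_card_fiber_lt (T := ZMod cs × Fin c₁ × Fin c₂) hρ
    (fun x => p x y) (fun x => hp0 x y) (by rwa [hT])
  rw [hT] at hex
  choose f hf using hex
  set D : ℝ := ((cs * c₁ * c₂ : ℕ) : ℝ) - Real.logb 2 (Fintype.card 𝒳) - 2 with hD
  have hD0 : 0 < D := by linarith
  have hS0 : ∀ y, 0 ≤ ∑ x, p x y ^ (1 / (1 + ρ)) := fun y =>
    Finset.sum_nonneg fun x _ => Real.rpow_nonneg (hp0 x y) _
  have hpos : 0 < ∑ y, (∑ x, p x y ^ (1 / (1 + ρ))) ^ (1 + ρ) := by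
    obtain ⟨x₀, y₀, h₀⟩ : ∃ x y, 0 < p x y := by
      by_contra! h
      have : ∀ x y, p x y = 0 := fun x y => le_antisymm (h x y) (hp0 x y)
      simp [this] at hp1
    refine Finset.sum_pos' (fun y _ => Real.rpow_nonneg (hS0 y) _) ⟨y₀, Finset.mem_univ _, ?_⟩
    refine Real.rpow_pos_of_pos ?_ _
    exact Finset.sum_pos' (fun x _ => Real.rpow_nonneg (hp0 x y₀) _)
      ⟨x₀, Finset.mem_univ _, Real.rpow_pos_of_pos h₀ _⟩
  have hH := two_rpow_condRenyi hρ p hpos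
  have htwo : ∀ {c : ℝ}, 0 < c → (2 : ℝ) ^ (ρ * Real.logb 2 c) = c ^ ρ := fun {c} hc => by
    rw [mul_comm, Real.rpow_mul (by norm_num), Real.rpow_logb (by norm_num) (by norm_num) hc]
  refine ⟨padEncoder ι₁ ι₂ fun x y => f y x, padEncoder_nonneg _ _ _, sum_padEncoder _ _ _,
    ?_, ?_⟩
  · refine (bobListAmb_padEncoder_lt p hp0 hp1 ι₁.injective ι₂.injective (fun x y => f y x)
      (fun x y => (4 * (∑ x', p x' y ^ (1 / (1 + ρ))) / D) ^ ρ * p x y ^ (1 / (1 + ρ)))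
      (fun x y => ?_) fun x y => hf y x).trans_eq ?_
    · have := hS0 y
      have := hp0 x y
      positivity
    · have hexp : ρ * (condRenyi ρ p - Real.logb 2 D + 2) =
          ρ * condRenyi ρ p - ρ * Real.logb 2 D + ρ * 2 := by ring
      have h4 : (2 : ℝ) ^ (ρ * 2) = 4 ^ ρ := by
        rw [mul_comm, Real.rpow_mul (by norm_num)]
        norm_num
      rw [hexp, Real.rpow_add (by norm_num), Real.rpow_sub (by norm_num), hH, htwo hD0, h4]
      congr 1
      rw [div_mul_eq_mul_div, Finset.sum_mul, Finset.sum_div]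
      refine Finset.sum_congr rfl fun y _ => ?_
      have hS := hS0 y
      rw [← Finset.mul_sum, Real.div_rpow (by positivity) hD0.le, Real.mul_rpow (by norm_num) hS,
        Real.rpow_add_of_nonneg hS zero_le_one hρ.le, Real.rpow_one]
      ring
  · have hlog : 0 ≤ Real.log (Fintype.card 𝒳) := Real.log_natCast_nonneg _
    have hc : (0 : ℝ) < ((c₁ + c₂ : ℕ) : ℝ) := by positivity
    refine le_trans (le_of_eq ?_) (le_eveAmb_padEncoder hρ p hp0 ι₁ ι₂ fun x y => f y x)
    rw [mul_sub, Real.rpow_sub (by norm_num), hH, htwo hc, Fintype.card_fin, Fintype.card_fin,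
      ← Nat.cast_add, Real.mul_rpow hc.le (by positivity), Real.rpow_neg hc.le]
    ring
end
end
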